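/- arXiv:2503.10176 — 4 statements merged into one kernel-verified Lean document; each statement's English description precedes it below -/
import Mathlib

section
/- For all natural numbers m and n, the logic NAmn enjoys the uniform Lyndon interpolation property (ULIP): for every modal formula φ and all finite sets P⁺, P⁻ of propositional variables, there exists a modal formula χ such that V^•(χ) ⊆ V^•(φ) \ P^• for each • ∈ {+,−}, NAmn ⊢ φ → χ, and NAmn ⊢ χ → ψ for every modal formula ψ such that NAmn ⊢ φ → ψ and V^•(ψ) ∩ P^• = ∅ for each • ∈ {+,−}. -/
/-- Propositional formulas. -/
inductive PropForm : Type
  | var : ℕ → PropForm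
  | fls : PropForm
  | and : PropForm → PropForm → PropForm
  | or : PropForm → PropForm → PropForm
  | imp : PropForm → PropForm → PropForm
  deriving DecidableEq

/-- Boolean evaluation of a propositional formula. -/
def PropForm.eval (v : ℕ → Bool) : PropForm → Bool
  | .var i => v i
  | .fls => false
  | .and φ ψ => φ.eval v && ψ.eval v
  | .or φ ψ => φ.eval v || ψ.eval v
  | .imp φ ψ => !φ.eval v || ψ.eval v

/-- Classical propositional tautology. -/
def PropForm.Taut (φ : PropForm) : Prop := ∀ v, φ.eval v = true

/-- Modal formulas. -/
inductive ModalForm : Type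
  | var : ℕ → ModalForm
  | fls : ModalForm
  | and : ModalForm → ModalForm → ModalForm
  | or : ModalForm → ModalForm → ModalForm
  | imp : ModalForm → ModalForm → ModalForm
  | box : ModalForm → ModalForm
  deriving DecidableEq

/-- Substitution of modal formulas for the variables of a propositional formula. -/
def PropForm.subst (σ : ℕ → ModalForm) : PropForm → ModalForm
  | .var i => σ i
  | .fls => .fls
  | .and φ ψ => .and (φ.subst σ) (ψ.subst σ)
  | .or φ ψ => .or (φ.subst σ) (ψ.subst σ)
  | .imp φ ψ => .imp (φ.subst σ) (ψ.subst σ)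

/-- ¬φ abbreviates φ → ⊥. -/
def ModalForm.neg (φ : ModalForm) : ModalForm := .imp φ .fls

/-- □^k φ : k-fold application of □. -/
def ModalForm.boxIter : ℕ → ModalForm → ModalForm
  | 0, φ => φ
  | k + 1, φ => .box (ModalForm.boxIter k φ)

/-- ¬^j φ : j-fold application of ¬. -/
def ModalForm.negIter : ℕ → ModalForm → ModalForm
  | 0, φ => φ
  | k + 1, φ => (ModalForm.negIter k φ).neg

/-- φ ↔ ψ abbreviates (φ → ψ) ∧ (ψ → φ). -/
def ModalForm.iff (φ ψ : ModalForm) : ModalForm := .and (.imp φ ψ) (.imp ψ φ)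

/-- Signed variables: `Vsgn φ true` is V⁺(φ), `Vsgn φ false` is V⁻(φ). -/
def ModalForm.Vsgn : ModalForm → Bool → Finset ℕ
  | .var i, true => {i}
  | .var _, false => ∅
  | .fls, _ => ∅
  | .and φ ψ, b => φ.Vsgn b ∪ ψ.Vsgn b
  | .or φ ψ, b => φ.Vsgn b ∪ ψ.Vsgn b
  | .imp φ ψ, b => φ.Vsgn (!b) ∪ ψ.Vsgn b
  | .box φ, b => φ.Vsgn b

/-- Positive variables V⁺(φ). -/
def ModalForm.Vpos (φ : ModalForm) : Finset ℕ := φ.Vsgn true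

/-- Negative variables V⁻(φ). -/
def ModalForm.Vneg (φ : ModalForm) : Finset ℕ := φ.Vsgn false

/-- All variables V(φ). -/
def ModalForm.V (φ : ModalForm) : Finset ℕ := φ.Vpos ∪ φ.Vneg

/-- The logic NAmn = N + (Amn : □ⁿφ → □ᵐφ). -/
inductive NA (m n : ℕ) : ModalForm → Prop
  | taut (p : PropForm) (σ : ℕ → ModalForm) : p.Taut → NA m n (p.subst σ)
  | amn (φ : ModalForm) : NA m n (.imp (ModalForm.boxIter n φ) (ModalForm.boxIter m φ))
  | mp (φ ψ : ModalForm) : NA m n (.imp φ ψ) → NA m n φ → NA m n ψ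
  | nec (φ : ModalForm) : NA m n φ → NA m n (.box φ)

namespace ModalForm

/-- A truth assignment on modal formulas that respects the Boolean connectives and treats boxed
formulas as atoms. -/
structure IsHom (v : ModalForm → Prop) : Prop where
  fls : ¬ v .fls
  and : ∀ φ ψ, v (.and φ ψ) ↔ v φ ∧ v ψ
  or : ∀ φ ψ, v (.or φ ψ) ↔ v φ ∨ v ψ
  imp : ∀ φ ψ, v (.imp φ ψ) ↔ (v φ → v ψ)

theorem IsHom.neg {v : ModalForm → Prop} (hv : IsHom v) (φ : ModalForm) :
    v φ.neg ↔ ¬ v φ := by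
  have := hv.fls
  simp [ModalForm.neg, hv.imp, this]

/-- The subformulas of `φ` with positive (`true`) or negative (`false`) occurrences. -/
def ssub : ModalForm → Bool → Finset ModalForm
  | .var i, b => if b then {.var i} else ∅
  | .fls, b => if b then {.fls} else ∅
  | .and φ ψ, b => (if b then {.and φ ψ} else ∅) ∪ (φ.ssub b ∪ ψ.ssub b)
  | .or φ ψ, b => (if b then {.or φ ψ} else ∅) ∪ (φ.ssub b ∪ ψ.ssub b)
  | .imp φ ψ, b => (if b then {.imp φ ψ} else ∅) ∪ (φ.ssub (!b) ∪ ψ.ssub b)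
  | .box φ, b => (if b then {.box φ} else ∅) ∪ φ.ssub b

theorem self_mem_ssub (φ : ModalForm) : φ ∈ φ.ssub true := by
  cases φ <;> simp [ssub]

/-- A pair of predicates closed under signed subformulas. -/
structure SignedClosed (A : Bool → ModalForm → Prop) : Prop where
  and : ∀ b φ ψ, A b (.and φ ψ) → A b φ ∧ A b ψ
  or : ∀ b φ ψ, A b (.or φ ψ) → A b φ ∧ A b ψ
  imp : ∀ b φ ψ, A b (.imp φ ψ) → A (!b) φ ∧ A b ψ
  box : ∀ b φ, A b (.box φ) → A b φ

theorem SignedClosed.flip {A : Bool → ModalForm → Prop} (hA : SignedClosed A) :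
    SignedClosed fun b => A (!b) :=
  ⟨fun b => hA.and (!b), fun b => hA.or (!b), fun b => hA.imp (!b), fun b => hA.box (!b)⟩

theorem SignedClosed.boxIter {A : Bool → ModalForm → Prop} (hA : SignedClosed A) {b : Bool}
    {j k : ℕ} (hjk : j ≤ k) {φ : ModalForm} (h : A b (boxIter k φ)) : A b (boxIter j φ) := by
  induction k, hjk using Nat.le_induction with
  | base => exact h
  | succ k _ ih => exact ih (hA.box _ _ h)

theorem signedClosed_ssub (θ : ModalForm) : SignedClosed fun b a => a ∈ θ.ssub b := by
  induction θ with
  | var i => constructor <;> intro b <;> cases b <;> simp [ssub]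
  | fls => constructor <;> intro b <;> cases b <;> simp [ssub]
  | and x y ihx ihy =>
    obtain ⟨_, _, _, _⟩ := ihx
    have hx := self_mem_ssub x
    obtain ⟨_, _, _, _⟩ := ihy
    have hy := self_mem_ssub y
    constructor <;> intro b <;> cases b <;> simp [ssub] <;> grind
  | or x y ihx ihy =>
    obtain ⟨_, _, _, _⟩ := ihx
    have hx := self_mem_ssub x
    obtain ⟨_, _, _, _⟩ := ihy
    have hy := self_mem_ssub y
    constructor <;> intro b <;> cases b <;> simp [ssub] <;> grind
  | imp x y ihx ihy =>
    obtain ⟨_, _, _, _⟩ := ihx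
    have hx := self_mem_ssub x
    obtain ⟨_, _, _, _⟩ := ihy
    have hy := self_mem_ssub y
    constructor <;> intro b <;> cases b <;> simp [ssub] <;> grind
  | box x ihx =>
    obtain ⟨_, _, _, _⟩ := ihx
    have hx := self_mem_ssub x
    constructor <;> intro b <;> cases b <;> simp [ssub] <;> grind

theorem Vsgn_subset_of_mem_ssub {θ a : ModalForm} {b : Bool} (h : a ∈ θ.ssub b) (c : Bool) :
    a.Vsgn (c == b) ⊆ θ.Vsgn c := by
  induction θ generalizing b c with
  | var i => cases b <;> cases c <;> simp_all [ssub]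
  | fls => cases b <;> cases c <;> simp_all [ssub]
  | and x y ihx ihy =>
    simp only [ssub, Finset.mem_union] at h
    rcases h with h | h | h
    · cases b <;> cases c <;> simp_all
    · exact (ihx h c).trans Finset.subset_union_left
    · exact (ihy h c).trans Finset.subset_union_right
  | or x y ihx ihy =>
    simp only [ssub, Finset.mem_union] at h
    rcases h with h | h | h
    · cases b <;> cases c <;> simp_all
    · exact (ihx h c).trans Finset.subset_union_left
    · exact (ihy h c).trans Finset.subset_union_right
  | imp x y ihx ihy =>
    simp only [ssub, Finset.mem_union] at h
    rcases h with h | h | h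
    · cases b <;> cases c <;> simp_all
    · have := ihx h (!c)
      rw [show ((!c) == !b) = (c == b) by cases b <;> cases c <;> rfl] at this
      exact this.trans Finset.subset_union_left
    · exact (ihy h c).trans Finset.subset_union_right
  | box x ihx =>
    simp only [ssub, Finset.mem_union] at h
    rcases h with h | h
    · cases b <;> cases c <;> simp_all
    · exact ihx h c

/-- `a` is a subformula of `φ`. -/
def Sub (φ a : ModalForm) : Prop := ∃ b, a ∈ φ.ssub b

theorem Sub.refl (φ : ModalForm) : Sub φ φ := ⟨true, self_mem_ssub φ⟩

theorem signedClosed_sub (φ : ModalForm) : SignedClosed fun _ => Sub φ := by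
  have H := signedClosed_ssub φ
  constructor
  · rintro - x y ⟨b, h⟩
    exact ⟨⟨b, (H.and b x y h).1⟩, ⟨b, (H.and b x y h).2⟩⟩
  · rintro - x y ⟨b, h⟩
    exact ⟨⟨b, (H.or b x y h).1⟩, ⟨b, (H.or b x y h).2⟩⟩
  · rintro - x y ⟨b, h⟩
    exact ⟨⟨!b, (H.imp b x y h).1⟩, ⟨b, (H.imp b x y h).2⟩⟩
  · rintro - x ⟨b, h⟩
    exact ⟨b, H.box b x h⟩

theorem sub_box {σ a : ModalForm} (h : Sub (.box σ) a) : a = .box σ ∨ Sub σ a := by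
  obtain ⟨b, h⟩ := h
  cases b
  · exact .inr ⟨false, by simpa [ssub] using h⟩
  · simp only [ssub, if_true, Finset.mem_union, Finset.mem_singleton] at h
    exact h.imp_right fun h => ⟨true, h⟩

theorem sizeOf_le_of_mem_ssub {θ a : ModalForm} {b : Bool} (h : a ∈ θ.ssub b) :
    sizeOf a ≤ sizeOf θ := by
  induction θ generalizing b with
  | var i => cases b <;> simp_all [ssub]
  | fls => cases b <;> simp_all [ssub]
  | and x y ihx ihy => cases b <;> simp [ssub] at h <;> grind
  | or x y ihx ihy => cases b <;> simp [ssub] at h <;> grind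
  | imp x y ihx ihy => cases b <;> simp [ssub] at h <;> grind
  | box x ihx => cases b <;> simp [ssub] at h <;> grind

theorem Sub.sizeOf_le {θ a : ModalForm} (h : Sub θ a) : sizeOf a ≤ sizeOf θ :=
  h.elim fun _ => sizeOf_le_of_mem_ssub

theorem sizeOf_boxIter (k : ℕ) (φ : ModalForm) : sizeOf (boxIter k φ) = k + sizeOf φ := by
  induction k with
  | zero => simp [boxIter]
  | succ k ih => simp [boxIter, ih]; omega

/-- Local validity: `φ` holds under every assignment that makes the axiom `□ⁿρ → □ᵐρ` true and
the valid boxed formulas true, as far as these concern subformulas of `φ` only. -/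
def LocValid (m n : ℕ) (φ : ModalForm) : Prop :=
  ∀ v : ModalForm → Prop, IsHom v →
    (∀ σ, (h : Sub φ (.box σ)) → LocValid m n σ → v (.box σ)) →
    (∀ ρ, Sub φ (boxIter n ρ) → Sub φ (boxIter m ρ) → v (boxIter n ρ) → v (boxIter m ρ)) → v φ
termination_by sizeOf φ
decreasing_by
  have := h.sizeOf_le
  simp at this
  omega

/-- `v` is an assignment that satisfies the axiom and necessitation within `S`. -/
structure GoodOn (m n : ℕ) (S : ModalForm → Prop) (v : ModalForm → Prop) : Prop where
  hom : IsHom v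
  nec : ∀ σ, S (.box σ) → LocValid m n σ → v (.box σ)
  amn : ∀ ρ, S (boxIter n ρ) → S (boxIter m ρ) → v (boxIter n ρ) → v (boxIter m ρ)

theorem GoodOn.mono {m n : ℕ} {S T v : ModalForm → Prop} (h : GoodOn m n T v)
    (hST : ∀ a, S a → T a) : GoodOn m n S v :=
  ⟨h.hom, fun σ hσ => h.nec σ (hST _ hσ), fun ρ h₁ h₂ => h.amn ρ (hST _ h₁) (hST _ h₂)⟩

theorem locValid_iff {m n : ℕ} {φ : ModalForm} :
    LocValid m n φ ↔ ∀ v, GoodOn m n (Sub φ) v → v φ := by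
  rw [LocValid]
  exact ⟨fun h v hv => h v hv.hom hv.nec hv.amn, fun h v h₁ h₂ h₃ => h v ⟨h₁, h₂, h₃⟩⟩

/-- The homomorphic extension of an assignment of truth values to variables and boxed formulas. -/
def extend (r : ModalForm → Prop) : ModalForm → Prop
  | .var i => r (.var i)
  | .fls => False
  | .and φ ψ => extend r φ ∧ extend r ψ
  | .or φ ψ => extend r φ ∨ extend r ψ
  | .imp φ ψ => extend r φ → extend r ψ
  | .box φ => r (.box φ)

theorem isHom_extend (r : ModalForm → Prop) : IsHom (extend r) := by
  constructor <;> simp [extend]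

/-- Comparison of two assignments along signed subformulas. -/
theorem SignedClosed.transfer {A : Bool → ModalForm → Prop} (hA : SignedClosed A)
    {u v : ModalForm → Prop} (hu : IsHom u) (hv : IsHom v)
    (hvar : ∀ i, (A true (.var i) → v (.var i) → u (.var i)) ∧
      (A false (.var i) → u (.var i) → v (.var i)))
    (hbox : ∀ φ, (A true (.box φ) → v (.box φ) → u (.box φ)) ∧
      (A false (.box φ) → u (.box φ) → v (.box φ))) (θ : ModalForm) :
    (A true θ → v θ → u θ) ∧ (A false θ → u θ → v θ) := by
  induction θ with
  | var i => exact hvar i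
  | fls => exact ⟨fun _ h => (hv.fls h).elim, fun _ h => (hu.fls h).elim⟩
  | and x y ihx ihy =>
    have h₁ := hA.and true x y
    have h₂ := hA.and false x y
    rw [hu.and, hv.and]
    tauto
  | or x y ihx ihy =>
    have h₁ := hA.or true x y
    have h₂ := hA.or false x y
    rw [hu.or, hv.or]
    tauto
  | imp x y ihx ihy =>
    have h₁ := hA.imp true x y
    have h₂ := hA.imp false x y
    rw [hu.imp, hv.imp]
    simp only [Bool.not_true, Bool.not_false] at h₁ h₂
    tauto
  | box x => exact hbox x

theorem LocValid.of_box {m n : ℕ} (hmn : m < n) {σ : ModalForm} (h : LocValid m n (.box σ)) :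
    LocValid m n σ := by
  by_contra hσ
  have hσ' := hσ
  rw [locValid_iff] at hσ
  push Not at hσ
  obtain ⟨v, hv, hvσ⟩ := hσ
  set u := extend fun a => v a ∧ a ≠ .box σ with hu
  have hne : ∀ a, Sub σ a → a ≠ .box σ := by
    rintro _ ha rfl
    have := ha.sizeOf_le
    simp at this
  have key : ∀ θ, Sub σ θ → (u θ ↔ v θ) := fun θ hθ => by
    have := (signedClosed_sub σ).transfer (isHom_extend _) hv.hom (u := u)
      (fun i => by simp [hu, extend])
      (fun φ => ⟨fun h₁ h₂ => ⟨h₂, hne _ h₁⟩, fun _ h₂ => h₂.1⟩) θ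
    exact ⟨this.2 hθ, this.1 hθ⟩
  have hbox : ¬ u (.box σ) := fun h => h.2 rfl
  refine hbox (locValid_iff.1 h u ⟨isHom_extend _, ?_, ?_⟩)
  · intro τ hτ hL
    rcases sub_box hτ with h₁ | h₁
    · cases h₁
      exact (hσ' hL).elim
    · exact (key _ h₁).2 (hv.nec τ h₁ hL)
  · intro ρ h₁ h₂ h₃
    rcases sub_box h₁ with h₄ | h₄
    · exact (hbox (h₄ ▸ h₃)).elim
    · have h₅ := (signedClosed_sub σ).boxIter (b := true) hmn.le h₄
      exact (key _ h₅).2 (hv.amn ρ h₄ h₅ ((key _ h₄).1 h₃))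

theorem LocValid.of_boxIter {m n : ℕ} (hmn : m < n) {j k : ℕ} (hjk : j ≤ k) {φ : ModalForm}
    (h : LocValid m n (boxIter k φ)) : LocValid m n (boxIter j φ) := by
  induction k, hjk using Nat.le_induction with
  | base => exact h
  | succ k _ ih => exact ih (LocValid.of_box hmn h)

/-- The assignment between the lower bound `lo` and the upper bound `up` that identifies `□ⁿρ`
with `□ᵐρ`, for `m < n`, as far as the bounds permit. -/
def between (m n : ℕ) (lo up : ModalForm → Prop) : ModalForm → Prop
  | .var i => up (.var i)
  | .fls => False
  | .and φ ψ => between m n lo up φ ∧ between m n lo up ψ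
  | .or φ ψ => between m n lo up φ ∨ between m n lo up ψ
  | .imp φ ψ => between m n lo up φ → between m n lo up ψ
  | .box φ => lo (.box φ) ∨ (up (.box φ) ∧
      ∀ (_ : m < n) (ρ : ModalForm) (_ : ModalForm.box φ = boxIter n ρ),
        between m n lo up (boxIter m ρ))
termination_by φ => sizeOf φ
decreasing_by
  all_goals simp_wf
  all_goals try omega
  rename_i h₁ h₂
  have := congrArg sizeOf h₂
  simp only [sizeOf_boxIter, box.sizeOf_spec] at this ⊢
  omega

theorem isHom_between (m n : ℕ) (lo up : ModalForm → Prop) : IsHom (between m n lo up) := by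
  constructor <;> simp [between]

theorem exists_eq_box_of_pos {k : ℕ} (hk : 0 < k) (φ : ModalForm) :
    boxIter k φ = .box (boxIter (k - 1) φ) := by
  obtain ⟨k, rfl⟩ := Nat.exists_eq_succ_of_ne_zero hk.ne'
  rfl

/-- Compatible families of partially good assignments have a common good refinement. -/
theorem exists_amalgam {m n : ℕ} {ι : Type*} (A : ι → Bool → ModalForm → Prop)
    (hA : ∀ i, SignedClosed (A i)) (v : ι → ModalForm → Prop)
    (hv : ∀ i, GoodOn m n (fun a => ∃ b, A i b a) (v i))
    (hcompat : ∀ i j a, A i true a → A j false a → v i a → v j a) :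
    ∃ u, GoodOn m n (fun _ => True) u ∧
      ∀ i θ, (A i true θ → v i θ → u θ) ∧ (A i false θ → u θ → v i θ) := by
  set lo : ModalForm → Prop := fun a => ∃ i, A i true a ∧ v i a with hlo
  set up : ModalForm → Prop := fun a => ∀ i, A i false a → v i a with hup
  have hlu : ∀ a, lo a → up a := fun a ⟨i, h₁, h₂⟩ j h₃ => hcompat i j a h₁ h₃ h₂
  set u := between m n lo up with hu
  have hom : IsHom u := isHom_between m n lo up
  have ubox (φ : ModalForm) : u (.box φ) ↔ lo (.box φ) ∨ (up (.box φ) ∧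
      (m < n → ∀ ρ, ModalForm.box φ = boxIter n ρ → u (boxIter m ρ))) := by
    rw [hu, between]
  have uvar (i : ℕ) : u (.var i) ↔ up (.var i) := by rw [hu, between]
  have key : ∀ i θ, (A i true θ → v i θ → u θ) ∧ (A i false θ → u θ → v i θ) := by
    intro i
    refine (hA i).transfer hom (hv i).hom (fun k => ?_) (fun φ => ?_)
    · exact ⟨fun h₁ h₂ => (uvar k).2 (hlu _ ⟨i, h₁, h₂⟩), fun h₁ h₂ => (uvar k).1 h₂ i h₁⟩
    · refine ⟨fun h₁ h₂ => (ubox φ).2 (.inl ⟨i, h₁, h₂⟩), fun h₁ h₂ => ?_⟩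
      rcases (ubox φ).1 h₂ with h₃ | h₃
      · exact hlu _ h₃ i h₁
      · exact h₃.1 i h₁
  have hamn : ∀ ρ, u (boxIter n ρ) → u (boxIter m ρ) := by
    intro ρ h
    rcases lt_trichotomy m n with hmn | rfl | hmn
    · have e := exists_eq_box_of_pos (Nat.zero_lt_of_lt hmn) ρ
      rw [e, ubox] at h
      rcases h with ⟨i, h₁, h₂⟩ | ⟨-, h₂⟩
      · rw [← e] at h₁ h₂
        have h₃ := (hA i).boxIter hmn.le h₁
        exact (key i _).1 h₃ ((hv i).amn ρ ⟨_, h₁⟩ ⟨_, h₃⟩ h₂)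
      · exact h₂ hmn ρ e.symm
    · exact h
    · have e := exists_eq_box_of_pos (Nat.zero_lt_of_lt hmn) ρ
      rw [e, ubox]
      refine .inr ⟨fun i h₁ => ?_, fun h => (hmn.not_gt h).elim⟩
      rw [← e] at h₁ ⊢
      have h₃ := (hA i).boxIter hmn.le h₁
      exact (hv i).amn ρ ⟨_, h₃⟩ ⟨_, h₁⟩ ((key i _).2 h₃ h)
  have hnec : ∀ k σ, sizeOf σ ≤ k → LocValid m n σ → u (.box σ) := by
    intro k
    induction k with
    | zero => intro σ hσ; cases σ <;> simp at hσ
    | succ k ih =>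
      intro σ hσ hL
      rw [ubox]
      refine .inr ⟨fun i h => (hv i).nec σ ⟨_, h⟩ hL, fun hmn ρ e => ?_⟩
      rw [exists_eq_box_of_pos (Nat.zero_lt_of_lt hmn)] at e
      injection e with e
      subst e
      rw [sizeOf_boxIter] at hσ
      have hm := LocValid.of_boxIter hmn (j := m - 1) (by omega) hL
      rcases Nat.eq_zero_or_pos m with rfl | hm0
      · refine locValid_iff.1 hm u ⟨hom, fun τ h₁ h₂ => ih τ ?_ h₂, fun ρ _ _ => hamn ρ⟩
        have := h₁.sizeOf_le
        simp [sizeOf_boxIter] at this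
        omega
      · rw [exists_eq_box_of_pos hm0]
        refine ih _ ?_ hm
        rw [sizeOf_boxIter]
        omega
  exact ⟨u, ⟨hom, fun σ _ => hnec _ σ le_rfl, fun ρ _ _ => hamn ρ⟩, key⟩

theorem GoodOn.exists_extension {m n : ℕ} {φ : ModalForm} {v : ModalForm → Prop}
    (hv : GoodOn m n (Sub φ) v) :
    ∃ u, GoodOn m n (fun _ => True) u ∧ ∀ θ, Sub φ θ → (u θ ↔ v θ) := by
  obtain ⟨u, hu, h⟩ := exists_amalgam (ι := Unit) (fun _ _ => Sub φ)
    (fun _ => signedClosed_sub φ) (fun _ => v) (fun _ => hv.mono fun _ ⟨_, h⟩ => h)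
    (fun _ _ _ _ _ h => h)
  exact ⟨u, hu, fun θ hθ => ⟨(h () θ).2 hθ, (h () θ).1 hθ⟩⟩

theorem locValid_iff_forall_goodOn {m n : ℕ} {φ : ModalForm} :
    LocValid m n φ ↔ ∀ v, GoodOn m n (fun _ => True) v → v φ := by
  rw [locValid_iff]
  refine ⟨fun h v hv => h v (hv.mono fun _ _ => trivial), fun h v hv => ?_⟩
  obtain ⟨u, hu, huv⟩ := hv.exists_extension
  exact (huv φ (Sub.refl φ)).1 (h u hu)

open Classical in
theorem IsHom.subst_iff {v : ModalForm → Prop} (hv : IsHom v) (σ : ℕ → ModalForm)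
    (p : PropForm) : v (p.subst σ) ↔ p.eval (fun i => decide (v (σ i))) = true := by
  induction p with
  | var i => simp [PropForm.subst, PropForm.eval]
  | fls => simp [PropForm.subst, PropForm.eval, hv.fls]
  | and x y ihx ihy => simp [PropForm.subst, PropForm.eval, hv.and, ihx, ihy]
  | or x y ihx ihy => simp [PropForm.subst, PropForm.eval, hv.or, ihx, ihy]
  | imp x y ihx ihy =>
    simp [PropForm.subst, PropForm.eval, hv.imp, ihx, ihy, imp_iff_not_or]

theorem _root_.NA.locValid {m n : ℕ} {φ : ModalForm} (h : NA m n φ) : LocValid m n φ := by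
  induction h with
  | taut p σ hp => exact locValid_iff.2 fun v hv => (hv.hom.subst_iff σ p).2 (hp _)
  | amn φ =>
    exact locValid_iff_forall_goodOn.2 fun v hv =>
      (hv.hom.imp _ _).2 (hv.amn φ trivial trivial)
  | mp φ ψ _ _ ih₁ ih₂ =>
    rw [locValid_iff_forall_goodOn] at *
    exact fun v hv => (hv.hom.imp _ _).1 (ih₁ v hv) (ih₂ v hv)
  | nec φ _ ih => exact locValid_iff_forall_goodOn.2 fun v hv => hv.nec φ trivial ih

/-- An injective numbering of modal formulas. -/
def code : ModalForm → ℕ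
  | .var i => Nat.pair 0 i
  | .fls => Nat.pair 1 0
  | .and φ ψ => Nat.pair 2 (Nat.pair φ.code ψ.code)
  | .or φ ψ => Nat.pair 3 (Nat.pair φ.code ψ.code)
  | .imp φ ψ => Nat.pair 4 (Nat.pair φ.code ψ.code)
  | .box φ => Nat.pair 5 φ.code

theorem code_injective : Function.Injective code := by
  intro φ
  induction φ <;> intro ψ h <;> cases ψ <;> simp_all [code, Nat.pair_eq_pair] <;> grind

instance : Nonempty ModalForm := ⟨.fls⟩

/-- The propositional skeleton of a modal formula, with boxed formulas as variables. -/
def skeleton : ModalForm → PropForm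
  | .var i => .var (code (.var i))
  | .fls => .fls
  | .and φ ψ => .and φ.skeleton ψ.skeleton
  | .or φ ψ => .or φ.skeleton ψ.skeleton
  | .imp φ ψ => .imp φ.skeleton ψ.skeleton
  | .box φ => .var (code (.box φ))

theorem skeleton_subst (φ : ModalForm) :
    φ.skeleton.subst (Function.invFun code) = φ := by
  have h := Function.leftInverse_invFun code_injective
  induction φ <;> simp_all [skeleton, PropForm.subst, h _]

theorem _root_.NA.of_forall_isHom {m n : ℕ} {φ : ModalForm} (h : ∀ v, IsHom v → v φ) :
    NA m n φ := by
  rw [← skeleton_subst φ]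
  refine NA.taut _ _ fun b => ?_
  refine h (fun θ => θ.skeleton.eval b = true) ⟨?_, ?_, ?_, ?_⟩ <;>
    simp [skeleton, PropForm.eval, imp_iff_not_or]

theorem _root_.NA.of_list {m n : ℕ} (l : List ModalForm) (hl : ∀ γ ∈ l, NA m n γ)
    {φ : ModalForm} (h : ∀ v, IsHom v → (∀ γ ∈ l, v γ) → v φ) : NA m n φ := by
  induction l generalizing φ with
  | nil => exact NA.of_forall_isHom fun v hv => h v hv (by simp)
  | cons γ l ih =>
    refine NA.mp γ φ (ih (fun δ hδ => hl δ (by simp [hδ])) fun v hv hγ => ?_) (hl γ (by simp))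
    exact (hv.imp _ _).2 fun h' => h v hv (by simpa using ⟨h', hγ⟩)

open Classical in
theorem LocValid.provable {m n : ℕ} (k : ℕ) {φ : ModalForm} (hk : sizeOf φ ≤ k)
    (h : LocValid m n φ) : NA m n φ := by
  induction k generalizing φ with
  | zero => cases φ <;> simp at hk
  | succ k ih =>
    let S := φ.ssub true ∪ φ.ssub false
    have hS : ∀ a, Sub φ a → a ∈ S := by
      rintro a ⟨b, hb⟩
      cases b <;> simp [S, hb]
    let ax : ModalForm → ModalForm := fun ρ => .imp (boxIter n ρ) (boxIter m ρ)
    refine NA.of_list ((S ∪ S.image ax).filter (NA m n)).toList (by simp) fun v hv hγ => ?_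
    have hγ' : ∀ γ ∈ S ∪ S.image ax, NA m n γ → v γ := fun γ h₁ h₂ =>
      hγ γ (by rw [Finset.mem_toList, Finset.mem_filter]; exact ⟨h₁, h₂⟩)
    refine locValid_iff.1 h v ⟨hv, fun σ h₁ h₂ => ?_, fun ρ h₁ _ => ?_⟩
    · refine hγ' _ (Finset.mem_union_left _ (hS _ h₁)) (NA.nec _ (ih ?_ h₂))
      have := h₁.sizeOf_le
      simp at this
      omega
    · have h₃ : Sub φ ρ := (signedClosed_sub φ).boxIter (b := true) (Nat.zero_le n) h₁
      exact (hv.imp _ _).1 (hγ' _ (Finset.mem_union_right _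
        (Finset.mem_image_of_mem ax (hS _ h₃))) (NA.amn ρ))

/-- Soundness and completeness for good assignments. -/
theorem NA_iff_forall_goodOn {m n : ℕ} {φ : ModalForm} :
    NA m n φ ↔ ∀ v, GoodOn m n (fun _ => True) v → v φ := by
  rw [← locValid_iff_forall_goodOn]
  exact ⟨NA.locValid, LocValid.provable _ le_rfl⟩

theorem exists_conj (l : List ModalForm) : ∃ χ : ModalForm,
    (∀ c x, x ∈ χ.Vsgn c → ∃ a ∈ l, x ∈ a.Vsgn c) ∧
    ∀ v, IsHom v → (v χ ↔ ∀ a ∈ l, v a) := by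
  induction l with
  | nil => exact ⟨.imp .fls .fls, by simp [Vsgn], fun v hv => by simp [hv.imp]⟩
  | cons a l ih =>
    obtain ⟨χ, h₁, h₂⟩ := ih
    refine ⟨.and a χ, fun c x hx => ?_, fun v hv => by simp [hv.and, h₂ v hv]⟩
    rcases Finset.mem_union.1 hx with h | h
    · exact ⟨a, by simp, h⟩
    · obtain ⟨b, hb, hx⟩ := h₁ c x h
      exact ⟨b, by simp [hb], hx⟩

theorem exists_disj (l : List ModalForm) : ∃ χ : ModalForm,
    (∀ c x, x ∈ χ.Vsgn c → ∃ a ∈ l, x ∈ a.Vsgn c) ∧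
    ∀ v, IsHom v → (v χ ↔ ∃ a ∈ l, v a) := by
  induction l with
  | nil => exact ⟨.fls, by simp [Vsgn], fun v hv => by simp [hv.fls]⟩
  | cons a l ih =>
    obtain ⟨χ, h₁, h₂⟩ := ih
    refine ⟨.or a χ, fun c x hx => ?_, fun v hv => by simp [hv.or, h₂ v hv]⟩
    rcases Finset.mem_union.1 hx with h | h
    · exact ⟨a, by simp, h⟩
    · obtain ⟨b, hb, hx⟩ := h₁ c x h
      exact ⟨b, by simp [hb], hx⟩

open Classical in
/-- The strongest positive Boolean combination of the formulas in a finite set `Γ` that holds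
throughout a class `K` of assignments. -/
theorem exists_describe (Γ : Finset ModalForm) (K : (ModalForm → Prop) → Prop) :
    ∃ χ : ModalForm,
      (∀ c x, x ∈ χ.Vsgn c → ∃ a ∈ Γ, x ∈ a.Vsgn c) ∧
      ∀ w, IsHom w → (w χ ↔ ∃ v, K v ∧ ∀ a ∈ Γ, v a → w a) := by
  choose conj hconj₁ hconj₂ using exists_conj
  obtain ⟨χ, h₁, h₂⟩ := exists_disj
    (((Γ.powerset.filter fun X => ∃ v, K v ∧ X = Γ.filter v).toList).map
      fun X => conj X.toList)
  refine ⟨χ, fun c x hx => ?_, fun w hw => ?_⟩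
  · obtain ⟨a, ha, hx⟩ := h₁ c x hx
    simp only [List.mem_map, Finset.mem_toList, Finset.mem_filter, Finset.mem_powerset] at ha
    obtain ⟨X, ⟨hX, -⟩, rfl⟩ := ha
    obtain ⟨b, hb, hx⟩ := hconj₁ _ c x hx
    exact ⟨b, hX (Finset.mem_toList.1 hb), hx⟩
  · rw [h₂ w hw]
    simp only [List.mem_map, Finset.mem_toList, Finset.mem_filter, Finset.mem_powerset]
    constructor
    · rintro ⟨_, ⟨X, ⟨-, v, hv, rfl⟩, rfl⟩, hX⟩
      rw [hconj₂ _ w hw] at hX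
      exact ⟨v, hv, fun a ha hva => hX a (by simp [ha, hva])⟩
    · rintro ⟨v, hv, h⟩
      refine ⟨_, ⟨Γ.filter v, ⟨Finset.filter_subset _ _, v, hv, rfl⟩, rfl⟩, ?_⟩
      rw [hconj₂ _ w hw]
      intro a ha
      simp only [Finset.mem_toList, Finset.mem_filter] at ha
      exact h a ha.1 ha.2

open Classical in
/-- The literals over subformulas of `φ` that avoid the variables in `P`. -/
noncomputable def literals (φ : ModalForm) (P : Bool → Finset ℕ) : Finset ModalForm :=
  (φ.ssub true ∪ (φ.ssub false).image ModalForm.neg).filter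
    fun a => ∀ c, Disjoint (a.Vsgn c) (P c)

theorem Vsgn_neg (a : ModalForm) (c : Bool) : a.neg.Vsgn c = a.Vsgn (!c) := by
  simp [ModalForm.neg, Vsgn]

theorem Vsgn_subset_of_mem_literals {φ a : ModalForm} {P : Bool → Finset ℕ}
    (h : a ∈ φ.literals P) (c : Bool) : a.Vsgn c ⊆ φ.Vsgn c \ P c := by
  simp only [literals, Finset.mem_filter, Finset.mem_union, Finset.mem_image] at h
  refine Finset.subset_sdiff.2 ⟨?_, h.2 c⟩
  obtain ⟨h | ⟨b, h, rfl⟩, -⟩ := h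
  · simpa using Vsgn_subset_of_mem_ssub h c
  · simpa [Vsgn_neg] using Vsgn_subset_of_mem_ssub h c

/-- Good assignments that agree in the direction of the common literals can be joined. -/
theorem GoodOn.exists_join {m n : ℕ} {φ ψ : ModalForm} {P : Bool → Finset ℕ}
    (hP : ∀ c, Disjoint (ψ.Vsgn c) (P c)) {v w : ModalForm → Prop}
    (hv : GoodOn m n (fun _ => True) v) (hw : GoodOn m n (fun _ => True) w)
    (h : ∀ a ∈ φ.literals P, v a → w a) :
    ∃ u, GoodOn m n (fun _ => True) u ∧ (v φ → u φ) ∧ (u ψ → w ψ) := by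
  have hpos : ∀ a, a ∈ φ.ssub true → a ∈ ψ.ssub true → v a → w a := by
    intro a h₁ h₂
    refine h a ?_
    simp only [literals, Finset.mem_filter, Finset.mem_union]
    refine ⟨.inl h₁, fun c => (hP c).mono_left ?_⟩
    simpa using Vsgn_subset_of_mem_ssub h₂ c
  have hneg : ∀ a, a ∈ ψ.ssub false → a ∈ φ.ssub false → w a → v a := by
    intro a h₂ h₁ hwa
    by_contra hva
    refine (hw.hom.neg a).1 (h a.neg ?_ ((hv.hom.neg a).2 hva)) hwa
    simp only [literals, Finset.mem_filter, Finset.mem_union, Finset.mem_image]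
    refine ⟨.inr ⟨a, h₁, rfl⟩, fun c => (hP c).mono_left ?_⟩
    simpa [Vsgn_neg] using Vsgn_subset_of_mem_ssub h₂ c
  obtain ⟨u, hu, key⟩ := exists_amalgam (m := m) (n := n) (ι := Bool)
    (fun i b a => if i then a ∈ φ.ssub b else a ∈ ψ.ssub (!b))
    (by
      rintro (_ | _)
      · simpa using (signedClosed_ssub ψ).flip
      · simpa using signedClosed_ssub φ)
    (fun i => if i then v else w)
    (by
      rintro (_ | _)
      · simpa using hw.mono fun _ _ => trivial
      · simpa using hv.mono fun _ _ => trivial)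
    (by
      rintro (_ | _) (_ | _) a <;> simp
      · exact hneg a
      · exact hpos a)
  refine ⟨u, hu, ?_, ?_⟩
  · simpa [self_mem_ssub] using (key true φ).1
  · simpa [self_mem_ssub] using (key false ψ).2

end ModalForm

open ModalForm

/-- NA enjoys the uniform Lyndon interpolation property. -/
theorem NA_ULIP (m n : ℕ) (φ : ModalForm) (Pp Pm : Finset ℕ) :
    ∃ χ : ModalForm,
      χ.Vpos ⊆ φ.Vpos \ Pp ∧ χ.Vneg ⊆ φ.Vneg \ Pm ∧
      NA m n (.imp φ χ) ∧
      ∀ ψ : ModalForm, NA m n (.imp φ ψ) →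
        ψ.Vpos ∩ Pp = ∅ → ψ.Vneg ∩ Pm = ∅ → NA m n (.imp χ ψ) := by
  let P : Bool → Finset ℕ := fun b => if b then Pp else Pm
  obtain ⟨χ, hV, hχ⟩ := exists_describe (φ.literals P)
    fun v => GoodOn m n (fun _ => True) v ∧ v φ
  have hV' : ∀ c, χ.Vsgn c ⊆ φ.Vsgn c \ P c := fun c x hx => by
    obtain ⟨a, ha, hxa⟩ := hV c x hx
    exact Vsgn_subset_of_mem_literals ha c hxa
  refine ⟨χ, hV' true, hV' false, NA_iff_forall_goodOn.2 fun w hw => ?_,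
    fun ψ hψ h₁ h₂ => NA_iff_forall_goodOn.2 fun w hw => ?_⟩
  · exact (hw.hom.imp _ _).2 fun hφ => (hχ w hw.hom).2 ⟨w, ⟨hw, hφ⟩, fun _ _ h => h⟩
  · rw [hw.hom.imp, hχ w hw.hom]
    rintro ⟨v, ⟨hv, hvφ⟩, h⟩
    have hP : ∀ c, Disjoint (ψ.Vsgn c) (P c) := by
      rintro (_ | _)
      · exact Finset.disjoint_iff_inter_eq_empty.2 h₂
      · exact Finset.disjoint_iff_inter_eq_empty.2 h₁
    obtain ⟨u, hu, huφ, huψ⟩ := hv.exists_join hP hw h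
    exact huψ ((hu.hom.imp _ _).1 (NA_iff_forall_goodOn.1 hψ u hu) (huφ hvφ))
end

section
/- For all natural numbers m and n, the logic NpAmn enjoys the uniform Lyndon interpolation property (ULIP): for every modal formula φ and all finite sets P⁺, P⁻ of propositional variables, there exists a modal formula χ such that V^•(χ) ⊆ V^•(φ) \ P^• for each • ∈ {+,−}, NpAmn ⊢ φ → χ, and NpAmn ⊢ χ → ψ for every modal formula ψ such that NpAmn ⊢ φ → ψ and V^•(ψ) ∩ P^• = ∅ for each • ∈ {+,−}. -/
/-- The logic NpAmn = NAmn + (Ros□ : from ¬□φ infer ¬□□φ). -/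
inductive NpA (m n : ℕ) : ModalForm → Prop
  | taut (p : PropForm) (σ : ℕ → ModalForm) : p.Taut → NpA m n (p.subst σ)
  | amn (φ : ModalForm) : NpA m n (.imp (ModalForm.boxIter n φ) (ModalForm.boxIter m φ))
  | mp (φ ψ : ModalForm) : NpA m n (.imp φ ψ) → NpA m n φ → NpA m n ψ
  | nec (φ : ModalForm) : NpA m n φ → NpA m n (.box φ)
  | rosbox (φ : ModalForm) : NpA m n (ModalForm.neg (.box φ)) →
      NpA m n (ModalForm.neg (.box (.box φ)))

/-- A truth assignment on modal formulas that respects the Boolean connectives; variables and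
boxed formulas are treated as atoms. -/
structure IsBoolVal (V : ModalForm → Prop) : Prop where
  fls : ¬ V .fls
  and : ∀ α β, V (.and α β) ↔ V α ∧ V β
  or : ∀ α β, V (.or α β) ↔ V α ∨ V β
  imp : ∀ α β, V (.imp α β) ↔ (V α → V β)

namespace IsBoolVal

variable {V : ModalForm → Prop}

theorem neg (hV : IsBoolVal V) (α : ModalForm) : V α.neg ↔ ¬ V α := by
  simp [ModalForm.neg, hV.imp, hV.fls]

theorem taut (hV : IsBoolVal V) (p : PropForm) (σ : ℕ → ModalForm) (hp : p.Taut) :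
    V (p.subst σ) := by
  classical
  have key : ∀ q : PropForm, q.eval (fun i => decide (V (σ i))) = true ↔ V (q.subst σ) := by
    intro q
    induction q with
    | var i => simp [PropForm.eval, PropForm.subst]
    | fls => simp [PropForm.eval, PropForm.subst, hV.fls]
    | and p q ihp ihq => simp [PropForm.eval, PropForm.subst, hV.and, ← ihp, ← ihq]
    | or p q ihp ihq => simp [PropForm.eval, PropForm.subst, hV.or, ← ihp, ← ihq]
    | imp p q ihp ihq =>
      simp [PropForm.eval, PropForm.subst, hV.imp, ← ihp, ← ihq, imp_iff_not_or]
  exact (key p).1 (hp _)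

end IsBoolVal

/-- A Boolean assignment that makes every theorem of the logic true. -/
structure IsModel (m n : ℕ) (V : ModalForm → Prop) : Prop extends IsBoolVal V where
  sound : ∀ θ, NpA m n θ → V θ

/-! ### Completeness -/

/-- A set of formulas containing all theorems and closed under modus ponens. -/
structure IsTheory (m n : ℕ) (Γ : Set ModalForm) : Prop where
  thm : ∀ θ, NpA m n θ → θ ∈ Γ
  mp : ∀ α β, ModalForm.imp α β ∈ Γ → α ∈ Γ → β ∈ Γ

namespace IsTheory

variable {m n : ℕ} {Γ : Set ModalForm}

theorem taut (hΓ : IsTheory m n Γ) (p : PropForm) (σ : ℕ → ModalForm) (hp : p.Taut) :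
    p.subst σ ∈ Γ :=
  hΓ.thm _ (.taut p σ hp)

/-- The assignment `0 ↦ α, 1 ↦ β, i ↦ γ` otherwise. -/
def assign (α β γ : ModalForm) : ℕ → ModalForm
  | 0 => α
  | 1 => β
  | _ => γ

theorem imp_intro (hΓ : IsTheory m n Γ) (α : ModalForm) {β : ModalForm} (h : β ∈ Γ) :
    ModalForm.imp α β ∈ Γ := by
  have := hΓ.taut (.imp (.var 1) (.imp (.var 0) (.var 1))) (assign α β β)
    (by intro v; simp only [PropForm.eval]; cases v 0 <;> cases v 1 <;> rfl)
  exact hΓ.mp _ _ this h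

theorem extend (hΓ : IsTheory m n Γ) (α : ModalForm) :
    IsTheory m n {β | ModalForm.imp α β ∈ Γ} where
  thm θ h := hΓ.imp_intro α (hΓ.thm θ h)
  mp β γ h₁ h₂ := by
    have := hΓ.taut (.imp (.imp (.var 0) (.imp (.var 1) (.var 2)))
      (.imp (.imp (.var 0) (.var 1)) (.imp (.var 0) (.var 2)))) (assign α β γ)
      (by intro v; simp only [PropForm.eval]; cases v 0 <;> cases v 1 <;> cases v 2 <;> rfl)
    exact hΓ.mp _ _ (hΓ.mp _ _ this h₁) h₂

theorem isBoolVal_of_maximal (hΓ : IsTheory m n Γ) {θ : ModalForm} (hθ : θ ∉ Γ)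
    (hmax : ∀ α, α ∉ Γ → ModalForm.imp α θ ∈ Γ) : IsBoolVal (· ∈ Γ) where
  fls h := by
    have := hΓ.taut (.imp .fls (.var 0)) (assign θ θ θ)
      (by intro v; simp only [PropForm.eval]; cases v 0 <;> rfl)
    exact hθ (hΓ.mp _ _ this h)
  and α β := by
    refine ⟨fun h => ⟨?_, ?_⟩, fun h => ?_⟩
    · have := hΓ.taut (.imp (.and (.var 0) (.var 1)) (.var 0)) (assign α β θ)
        (by intro v; simp only [PropForm.eval]; cases v 0 <;> cases v 1 <;> rfl)
      exact hΓ.mp _ _ this h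
    · have := hΓ.taut (.imp (.and (.var 0) (.var 1)) (.var 1)) (assign α β θ)
        (by intro v; simp only [PropForm.eval]; cases v 0 <;> cases v 1 <;> rfl)
      exact hΓ.mp _ _ this h
    · have := hΓ.taut (.imp (.var 0) (.imp (.var 1) (.and (.var 0) (.var 1)))) (assign α β θ)
        (by intro v; simp only [PropForm.eval]; cases v 0 <;> cases v 1 <;> rfl)
      exact hΓ.mp _ _ (hΓ.mp _ _ this h.1) h.2
  or α β := by
    refine ⟨fun h => ?_, fun h => ?_⟩
    · by_contra hcon
      have hα := hmax α fun h => hcon (Or.inl h)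
      have hβ := hmax β fun h => hcon (Or.inr h)
      have := hΓ.taut (.imp (.imp (.var 0) (.var 2)) (.imp (.imp (.var 1) (.var 2))
        (.imp (.or (.var 0) (.var 1)) (.var 2)))) (assign α β θ)
        (by intro v; simp only [PropForm.eval]; cases v 0 <;> cases v 1 <;> cases v 2 <;> rfl)
      exact hθ (hΓ.mp _ _ (hΓ.mp _ _ (hΓ.mp _ _ this hα) hβ) h)
    · rcases h with h | h
      · have := hΓ.taut (.imp (.var 0) (.or (.var 0) (.var 1))) (assign α β θ)
          (by intro v; simp only [PropForm.eval]; cases v 0 <;> cases v 1 <;> rfl)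
        exact hΓ.mp _ _ this h
      · have := hΓ.taut (.imp (.var 1) (.or (.var 0) (.var 1))) (assign α β θ)
          (by intro v; simp only [PropForm.eval]; cases v 0 <;> cases v 1 <;> rfl)
        exact hΓ.mp _ _ this h
  imp α β := by
    refine ⟨fun h hα => hΓ.mp _ _ h hα, fun h => ?_⟩
    by_cases hα : α ∈ Γ
    · exact hΓ.imp_intro α (h hα)
    · by_contra hcon
      have := hΓ.taut (.imp (.imp (.imp (.var 0) (.var 1)) (.var 2))
        (.imp (.imp (.var 0) (.var 2)) (.var 2))) (assign α β θ)
        (by intro v; simp only [PropForm.eval]; cases v 0 <;> cases v 1 <;> cases v 2 <;> rfl)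
      exact hθ (hΓ.mp _ _ (hΓ.mp _ _ this (hmax _ hcon)) (hmax _ hα))

end IsTheory

theorem NpA.exists_model {m n : ℕ} {θ : ModalForm} (hθ : ¬ NpA m n θ) :
    ∃ V, IsModel m n V ∧ ¬ V θ := by
  have hbase : IsTheory m n {α | NpA m n α} := ⟨fun _ h => h, fun _ _ h₁ h₂ => .mp _ _ h₁ h₂⟩
  obtain ⟨Γ, -, hmax⟩ := zorn_subset_nonempty {Γ | IsTheory m n Γ ∧ θ ∉ Γ} (by
    rintro C hC hchain ⟨Δ, hΔ⟩
    refine ⟨⋃₀ C, ⟨⟨fun α h => ⟨Δ, hΔ, (hC hΔ).1.thm α h⟩, ?_⟩, ?_⟩,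
      fun s hs => Set.subset_sUnion_of_mem hs⟩
    · rintro α β ⟨s, hs, hαβ⟩ ⟨t, ht, hα⟩
      rcases hchain.total hs ht with hst | hts
      · exact ⟨t, ht, (hC ht).1.mp α β (hst hαβ) hα⟩
      · exact ⟨s, hs, (hC hs).1.mp α β hαβ (hts hα)⟩
    · rintro ⟨s, hs, h⟩
      exact (hC hs).2 h) _ ⟨hbase, hθ⟩
  refine ⟨(· ∈ Γ), ⟨hmax.prop.1.isBoolVal_of_maximal hmax.prop.2 fun α hα => ?_,
    hmax.prop.1.thm⟩, hmax.prop.2⟩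
  by_contra hcon
  refine hα (hmax.le_of_ge (y := {β | ModalForm.imp α β ∈ Γ})
    ⟨hmax.prop.1.extend α, hcon⟩ (fun β hβ => hmax.prop.1.imp_intro α hβ) ?_)
  exact hmax.prop.1.taut (.imp (.var 0) (.var 0)) (IsTheory.assign α α α)
    (by intro v; simp only [PropForm.eval]; cases v 0 <;> rfl)

/-! ### Assignments determined by their values on variables and boxed formulas -/

/-- The Boolean assignment with prescribed values on variables and boxed formulas. -/
def ModalForm.holds (A : ModalForm → Prop) : ModalForm → Prop
  | .var i => A (.var i)
  | .fls => False
  | .and α β => α.holds A ∧ β.holds A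
  | .or α β => α.holds A ∨ β.holds A
  | .imp α β => α.holds A → β.holds A
  | .box α => A (.box α)

theorem ModalForm.isBoolVal_holds (A : ModalForm → Prop) : IsBoolVal (ModalForm.holds A) where
  fls := id
  and _ _ := Iff.rfl
  or _ _ := Iff.rfl
  imp _ _ := Iff.rfl

/-- The Boolean assignment that ignores boxes. -/
def ModalForm.eraseHolds : ModalForm → Prop
  | .var _ => True
  | .fls => False
  | .and α β => α.eraseHolds ∧ β.eraseHolds
  | .or α β => α.eraseHolds ∨ β.eraseHolds
  | .imp α β => α.eraseHolds → β.eraseHolds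
  | .box α => α.eraseHolds

theorem ModalForm.isBoolVal_eraseHolds : IsBoolVal ModalForm.eraseHolds where
  fls := id
  and _ _ := Iff.rfl
  or _ _ := Iff.rfl
  imp _ _ := Iff.rfl

theorem ModalForm.eraseHolds_boxIter (k : ℕ) (α : ModalForm) :
    (boxIter k α).eraseHolds ↔ α.eraseHolds := by
  induction k with
  | zero => rfl
  | succ k ih => exact ih

theorem NpA.eraseHolds {m n : ℕ} {θ : ModalForm} (h : NpA m n θ) : θ.eraseHolds := by
  induction h with
  | taut p σ hp => exact ModalForm.isBoolVal_eraseHolds.taut p σ hp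
  | amn φ =>
    exact fun h => (ModalForm.eraseHolds_boxIter m φ).2 ((ModalForm.eraseHolds_boxIter n φ).1 h)
  | mp φ ψ _ _ ih₁ ih₂ => exact ih₁ ih₂
  | nec φ _ ih => exact ih
  | rosbox φ _ ih => exact ih

theorem NpA.not_neg_of {m n : ℕ} {θ : ModalForm} (h : NpA m n θ) : ¬ NpA m n θ.neg :=
  fun h' => h'.eraseHolds h.eraseHolds

theorem NpA.not_neg_box {m n : ℕ} (α : ModalForm) : ¬ NpA (m + 1) n (ModalForm.box α).neg := by
  have key : ∀ θ, NpA (m + 1) n θ → θ.holds fun _ => True := by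
    intro θ h
    induction h with
    | taut p σ hp => exact (ModalForm.isBoolVal_holds _).taut p σ hp
    | amn φ => exact fun _ => trivial
    | mp φ ψ _ _ ih₁ ih₂ => exact ih₁ ih₂
    | nec φ _ ih => trivial
    | rosbox φ _ ih => exact (ih trivial).elim
  exact fun h => key _ h trivial

/-! ### Amalgamating models along signed subformulas -/

/-- Closure of a signed set of formulas under signed subformulas. -/
structure SignedClosed (S : Bool → ModalForm → Prop) : Prop where
  and : ∀ b α β, S b (.and α β) → S b α ∧ S b β
  or : ∀ b α β, S b (.or α β) → S b α ∧ S b β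
  imp : ∀ b α β, S b (.imp α β) → S (!b) α ∧ S b β
  box : ∀ b α, S b (.box α) → S b α

theorem SignedClosed.of_boxIter {S : Bool → ModalForm → Prop} (hS : SignedClosed S) {b : Bool}
    {α : ModalForm} {k l : ℕ} (hkl : k ≤ l) (h : S b (.boxIter l α)) : S b (.boxIter k α) := by
  induction hkl with
  | refl => exact h
  | step _ ih => exact ih (hS.box _ _ h)

/-- Zero or more applications of the axiom `□ⁿφ → □ᵐφ`. -/
def AmnChain (m n : ℕ) : ModalForm → ModalForm → Prop :=
  Relation.ReflTransGen fun α β => ∃ γ, α = .boxIter n γ ∧ β = .boxIter m γ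

namespace AmnChain

variable {m n : ℕ} {α β : ModalForm}

theorem cons {γ : ModalForm} (h : AmnChain m n (.boxIter m γ) β) :
    AmnChain m n (.boxIter n γ) β :=
  Relation.ReflTransGen.head ⟨γ, rfl, rfl⟩ h

theorem holds {V : ModalForm → Prop} (hV : IsModel m n V) (h : AmnChain m n α β) (hα : V α) :
    V β := by
  induction h with
  | refl => exact hα
  | tail _ hstep ih =>
    obtain ⟨γ, rfl, rfl⟩ := hstep
    exact (hV.imp _ _).1 (hV.sound _ (.amn γ)) ih

theorem signed_right {S : Bool → ModalForm → Prop} (hS : SignedClosed S) {b : Bool} (hmn : m ≤ n)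
    (h : AmnChain m n α β) (hα : S b α) : S b β := by
  induction h with
  | refl => exact hα
  | tail _ hstep ih =>
    obtain ⟨γ, rfl, rfl⟩ := hstep
    exact hS.of_boxIter hmn ih

theorem signed_left {S : Bool → ModalForm → Prop} (hS : SignedClosed S) {b : Bool} (hnm : n ≤ m)
    (h : AmnChain m n α β) (hβ : S b β) : S b α := by
  induction h with
  | refl => exact hβ
  | tail _ hstep ih =>
    obtain ⟨γ, rfl, rfl⟩ := hstep
    exact ih (hS.of_boxIter hnm hβ)

end AmnChain

/-- A family of models `w i` with signed sets of formulas such that truth passes from positive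
formulas of one member to negative formulas of another. -/
structure Compatible {ι : Type} (m n : ℕ) (w : ι → ModalForm → Prop)
    (S : ι → Bool → ModalForm → Prop) : Prop where
  model : ∀ i, IsModel m n (w i)
  closed : ∀ i, SignedClosed (S i)
  compat : ∀ i j α, S i true α → S j false α → w i α → w j α

/-- `u` amalgamates the family: it is at least as true as every member on positive formulas, and
at most as true on negative ones. -/
def Amalgamates {ι : Type} (u : ModalForm → Prop) (w : ι → ModalForm → Prop)
    (S : ι → Bool → ModalForm → Prop) (α : ModalForm) : Prop :=
  ∀ i, (S i true α → w i α → u α) ∧ (S i false α → u α → w i α)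

/-- `α` is a negative formula refuted by some member of the family. -/
def Refuted {ι : Type} (w : ι → ModalForm → Prop) (S : ι → Bool → ModalForm → Prop)
    (α : ModalForm) : Prop :=
  ∃ i, S i false α ∧ ¬ w i α

namespace Compatible

variable {ι : Type} {m n : ℕ} {w : ι → ModalForm → Prop} {S : ι → Bool → ModalForm → Prop}

theorem amalgamates_of_atoms (hc : Compatible m n w S) {u : ModalForm → Prop} (hu : IsBoolVal u)
    {α : ModalForm} (hvar : ∀ p, Amalgamates u w S (.var p))
    (hbox : ∀ β, (∀ γ, sizeOf γ < sizeOf (ModalForm.box β) → Amalgamates u w S γ) →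
      Amalgamates u w S (.box β)) :
    Amalgamates u w S α := by
  induction hs : sizeOf α using Nat.strong_induction_on generalizing α with
  | _ s ih =>
    subst hs
    cases α with
    | var p => exact hvar p
    | fls => exact fun i => ⟨fun _ h => ((hc.model i).fls h).elim, fun _ h => (hu.fls h).elim⟩
    | and α β =>
      have hα := @ih (sizeOf α) (by simp; omega) α rfl
      have hβ := @ih (sizeOf β) (by simp) β rfl
      intro i
      rw [(hc.model i).and, hu.and]
      exact ⟨fun h hw => ⟨(hα i).1 ((hc.closed i).and _ _ _ h).1 hw.1,
          (hβ i).1 ((hc.closed i).and _ _ _ h).2 hw.2⟩,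
        fun h hw => ⟨(hα i).2 ((hc.closed i).and _ _ _ h).1 hw.1,
          (hβ i).2 ((hc.closed i).and _ _ _ h).2 hw.2⟩⟩
    | or α β =>
      have hα := @ih (sizeOf α) (by simp; omega) α rfl
      have hβ := @ih (sizeOf β) (by simp) β rfl
      intro i
      rw [(hc.model i).or, hu.or]
      exact ⟨fun h => Or.imp ((hα i).1 ((hc.closed i).or _ _ _ h).1)
          ((hβ i).1 ((hc.closed i).or _ _ _ h).2),
        fun h => Or.imp ((hα i).2 ((hc.closed i).or _ _ _ h).1)
          ((hβ i).2 ((hc.closed i).or _ _ _ h).2)⟩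
    | imp α β =>
      have hα := @ih (sizeOf α) (by simp; omega) α rfl
      have hβ := @ih (sizeOf β) (by simp) β rfl
      intro i
      rw [(hc.model i).imp, hu.imp]
      exact ⟨fun h hw hu => (hβ i).1 ((hc.closed i).imp _ _ _ h).2
          (hw ((hα i).2 ((hc.closed i).imp _ _ _ h).1 hu)),
        fun h hu hw => (hβ i).2 ((hc.closed i).imp _ _ _ h).2
          (hu ((hα i).1 ((hc.closed i).imp _ _ _ h).1 hw))⟩
    | box β => exact hbox β fun γ hγ => ih _ hγ rfl

theorem not_refuted (hc : Compatible m n w S) {i : ι} {α : ModalForm} (hα : S i true α)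
    (hw : w i α) : ¬ Refuted w S α :=
  fun ⟨j, hj, hwj⟩ => hwj (hc.compat i j α hα hj hw)

theorem not_refuted_of_chain (hc : Compatible m n w S) {i : ι} {α β : ModalForm} (hα : S i true α)
    (hw : w i α) (h : AmnChain m n α β) : ¬ Refuted w S β := by
  rintro ⟨j, hj, hwj⟩
  rcases le_total m n with hmn | hnm
  · exact hwj (hc.compat i j β (h.signed_right (hc.closed i) hmn hα) hj (h.holds (hc.model i) hw))
  · exact hwj (h.holds (hc.model j)
      (hc.compat i j α hα (h.signed_left (hc.closed j) hnm hj) hw))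

/-- Amalgamation when the conclusion of the axiom is boxed: a boxed formula is false only if the
axiom leads from it to a refuted formula. -/
theorem exists_amalgam_succ (hc : Compatible (m + 1) n w S) :
    ∃ u, IsModel (m + 1) n u ∧ ∀ α, Amalgamates u w S α := by
  set A : ModalForm → Prop := fun α => ∀ ε, AmnChain (m + 1) n α ε → ¬ Refuted w S ε
  have hu := ModalForm.isBoolVal_holds A
  have hatom : ∀ α, (∀ i, S i true α → w i α → A α) ∧ (∀ i, S i false α → A α → w i α) :=
    fun α => ⟨fun i hα hw ε hε => hc.not_refuted_of_chain hα hw hε,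
      fun i hα hAα => by_contra fun hw => hAα α Relation.ReflTransGen.refl ⟨i, hα, hw⟩⟩
  have ham : ∀ α, Amalgamates (ModalForm.holds A) w S α := fun α =>
    hc.amalgamates_of_atoms hu (fun p i => ⟨(hatom _).1 i, (hatom _).2 i⟩)
      fun β _ i => ⟨(hatom _).1 i, (hatom _).2 i⟩
  refine ⟨ModalForm.holds A, ⟨hu, fun θ hθ => ?_⟩, ham⟩
  induction hθ with
  | taut p σ hp => exact hu.taut p σ hp
  | amn γ =>
    rintro h ε hε ⟨i, hi, hw⟩
    have hchain : AmnChain (m + 1) n (.boxIter n γ) ε := AmnChain.cons hε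
    cases n with
    | zero =>
      exact hw (hchain.holds (hc.model i)
        ((ham γ i).2 (hchain.signed_left (hc.closed i) (Nat.zero_le _) hi) h))
    | succ n => exact h ε hchain ⟨i, hi, hw⟩
  | mp φ ψ _ _ ih₁ ih₂ => exact ih₁ ih₂
  | nec β hβ _ =>
    rintro ε hε ⟨i, -, hw⟩
    exact hw (hε.holds (hc.model i) ((hc.model i).sound _ (.nec β hβ)))
  | rosbox ψ hψ _ => exact (NpA.not_neg_box ψ hψ).elim

end Compatible

/-! ### The reflective case -/

/-- Derivations stratified by the nesting of the rules other than modus ponens. -/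
inductive NpAStage (m n : ℕ) : ℕ → ModalForm → Prop
  | taut (i : ℕ) (p : PropForm) (σ : ℕ → ModalForm) : p.Taut → NpAStage m n i (p.subst σ)
  | amn (i : ℕ) (φ : ModalForm) :
      NpAStage m n i (.imp (ModalForm.boxIter n φ) (ModalForm.boxIter m φ))
  | mp (i : ℕ) (φ ψ : ModalForm) :
      NpAStage m n i (.imp φ ψ) → NpAStage m n i φ → NpAStage m n i ψ
  | nec (i : ℕ) (φ : ModalForm) : NpAStage m n i φ → NpAStage m n (i + 1) (.box φ)
  | rosbox (i : ℕ) (φ : ModalForm) : NpAStage m n i (ModalForm.neg (.box φ)) →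
      NpAStage m n (i + 1) (ModalForm.neg (.box (.box φ)))

namespace NpAStage

variable {m n i j : ℕ} {θ : ModalForm}

theorem toNpA (h : NpAStage m n i θ) : NpA m n θ := by
  induction h with
  | taut _ p σ hp => exact .taut p σ hp
  | amn _ φ => exact .amn φ
  | mp _ φ ψ _ _ ih₁ ih₂ => exact .mp φ ψ ih₁ ih₂
  | nec _ φ _ ih => exact .nec φ ih
  | rosbox _ φ _ ih => exact .rosbox φ ih

theorem mono (h : NpAStage m n i θ) (hij : i ≤ j) : NpAStage m n j θ := by
  induction h generalizing j with
  | taut _ p σ hp => exact .taut _ p σ hp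
  | amn _ φ => exact .amn _ φ
  | mp _ φ ψ _ _ ih₁ ih₂ => exact .mp _ φ ψ (ih₁ hij) (ih₂ hij)
  | nec i φ _ ih =>
    obtain ⟨j, rfl⟩ := Nat.exists_eq_succ_of_ne_zero (Nat.ne_zero_of_lt hij)
    exact .nec j φ (ih (Nat.le_of_succ_le_succ hij))
  | rosbox i φ _ ih =>
    obtain ⟨j, rfl⟩ := Nat.exists_eq_succ_of_ne_zero (Nat.ne_zero_of_lt hij)
    exact .rosbox j φ (ih (Nat.le_of_succ_le_succ hij))

end NpAStage

theorem NpA.exists_stage {m n : ℕ} {θ : ModalForm} (h : NpA m n θ) : ∃ i, NpAStage m n i θ := by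
  induction h with
  | taut p σ hp => exact ⟨0, .taut _ p σ hp⟩
  | amn φ => exact ⟨0, .amn _ φ⟩
  | mp φ ψ _ _ ih₁ ih₂ =>
    obtain ⟨i, hi⟩ := ih₁
    obtain ⟨j, hj⟩ := ih₂
    exact ⟨max i j, .mp _ φ ψ (hi.mono (le_max_left i j)) (hj.mono (le_max_right i j))⟩
  | nec φ _ ih => exact ih.imp' _ fun i h => .nec i φ h
  | rosbox φ _ ih => exact ih.imp' _ fun i h => .rosbox i φ h

theorem ModalForm.sizeOf_le_boxIter (k : ℕ) (γ : ModalForm) : sizeOf γ ≤ sizeOf (boxIter k γ) := by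
  induction k with
  | zero => exact le_rfl
  | succ k ih => simp only [boxIter, box.sizeOf_spec]; omega

/-- The largest Boolean assignment refuting the atoms in `E` and satisfying `□ᵏ⁺¹γ → γ`. -/
def ModalForm.reflHolds (k : ℕ) (E : ModalForm → Prop) : ModalForm → Prop
  | .var i => ¬ E (.var i)
  | .fls => False
  | .and α β => α.reflHolds k E ∧ β.reflHolds k E
  | .or α β => α.reflHolds k E ∨ β.reflHolds k E
  | .imp α β => α.reflHolds k E → β.reflHolds k E
  | .box β => ¬ E (.box β) ∧ ∀ γ, (h : β = boxIter k γ) → γ.reflHolds k E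
termination_by α => sizeOf α
decreasing_by
  all_goals first
    | (simp; done)
    | (simp; omega)
    | (have := sizeOf_le_boxIter k γ; subst h; simp; omega)

theorem ModalForm.isBoolVal_reflHolds (k : ℕ) (E : ModalForm → Prop) :
    IsBoolVal (ModalForm.reflHolds k E) where
  fls := by simp [reflHolds]
  and _ _ := by rw [reflHolds]
  or _ _ := by rw [reflHolds]
  imp _ _ := by rw [reflHolds]

theorem ModalForm.reflHolds_box {k : ℕ} {E : ModalForm → Prop} {β : ModalForm} :
    (box β).reflHolds k E ↔ ¬ E (box β) ∧ ∀ γ, β = boxIter k γ → γ.reflHolds k E := by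
  rw [reflHolds]

theorem NpAStage.of_boxIter {m n i : ℕ}
    (hrefl : ∀ γ, NpAStage m n i (.box γ) → NpAStage m n i γ) (k : ℕ) {γ : ModalForm}
    (h : NpAStage m n i (.boxIter k γ)) : NpAStage m n i γ := by
  induction k with
  | zero => exact h
  | succ k ih => exact ih (hrefl _ h)

theorem NpAStage.reflHolds {k i j : ℕ} {E : ModalForm → Prop} {θ : ModalForm}
    (hnec : ∀ l < j, ∀ β, NpAStage 0 (k + 1) l β → ¬ E (.box β))
    (hros : ∀ β, NpA 0 (k + 1) (ModalForm.neg (.box β)) → E (.box (.box β)))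
    (hrefl : ∀ l < j, ∀ γ, NpAStage 0 (k + 1) l (.box γ) → NpAStage 0 (k + 1) l γ)
    (hij : i ≤ j) (h : NpAStage 0 (k + 1) i θ) : θ.reflHolds k E := by
  have hu := ModalForm.isBoolVal_reflHolds k E
  induction i using Nat.strong_induction_on generalizing θ with
  | _ i ih =>
    induction h with
    | taut _ p σ hp => exact hu.taut p σ hp
    | amn _ γ =>
      rw [hu.imp]
      exact fun h => (ModalForm.reflHolds_box.1 h).2 γ rfl
    | mp _ φ ψ _ _ ih₁ ih₂ => exact (hu.imp _ _).1 (ih₁ ih hij) (ih₂ ih hij)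
    | nec l β hβ _ =>
      refine ModalForm.reflHolds_box.2 ⟨hnec l hij β hβ, ?_⟩
      rintro γ rfl
      exact ih l l.lt_succ_self (Nat.le_of_lt hij) (NpAStage.of_boxIter (hrefl l hij) k hβ)
    | rosbox l β hβ _ =>
      rw [hu.neg]
      exact fun h => (ModalForm.reflHolds_box.1 h).1 (hros β hβ.toNpA)

theorem NpAStage.of_box {k j : ℕ} {ξ : ModalForm} (h : NpAStage 0 (k + 1) j (.box ξ)) :
    NpAStage 0 (k + 1) j ξ := by
  induction j using Nat.strong_induction_on generalizing ξ with
  | _ j ih =>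
    by_contra hξ
    have hbox := NpAStage.reflHolds
      (E := fun α => α = .box ξ ∨ ∃ β, α = .box (.box β) ∧ NpA 0 (k + 1) (ModalForm.neg (.box β)))
      (by
        rintro l hl β hβ (h | ⟨γ, h, hγ⟩)
        · cases h
          exact hξ (hβ.mono hl.le)
        · cases h
          exact hβ.toNpA.not_neg_of hγ)
      (fun β hβ => Or.inr ⟨β, rfl, hβ⟩) (fun l hl γ => ih l hl) le_rfl h
    exact (ModalForm.reflHolds_box.1 hbox).1 (Or.inl rfl)

/-- Amalgamation when the axiom is `□ᵏ⁺¹φ → φ`. -/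
theorem Compatible.exists_amalgam_refl {ι : Type} {k : ℕ} {w : ι → ModalForm → Prop}
    {S : ι → Bool → ModalForm → Prop} (hc : Compatible 0 (k + 1) w S) :
    ∃ u, IsModel 0 (k + 1) u ∧ ∀ α, Amalgamates u w S α := by
  set E : ModalForm → Prop := fun α => Refuted w S α ∨
    ∃ β, α = .box (.box β) ∧ NpA 0 (k + 1) (ModalForm.neg (.box β))
  have hu := ModalForm.isBoolVal_reflHolds k E
  refine ⟨ModalForm.reflHolds k E, ⟨hu, fun θ hθ => ?_⟩, fun α =>
    hc.amalgamates_of_atoms hu (fun p i => ?_) fun β ih i => ?_⟩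
  · obtain ⟨j, hj⟩ := hθ.exists_stage
    refine NpAStage.reflHolds ?_ (fun β hβ => Or.inr ⟨β, rfl, hβ⟩) (fun _ _ _ => NpAStage.of_box)
      le_rfl hj
    rintro l - β hβ (⟨i, -, hw⟩ | ⟨γ, h, hγ⟩)
    · exact hw ((hc.model i).sound _ (.nec β hβ.toNpA))
    · cases h
      exact hβ.toNpA.not_neg_of hγ
  · rw [ModalForm.reflHolds]
    refine ⟨fun hp hw => ?_, fun hp h => by_contra fun hw => h (Or.inl ⟨i, hp, hw⟩)⟩
    rintro (h | ⟨β, h, -⟩)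
    · exact hc.not_refuted hp hw h
    · cases h
  · rw [ModalForm.reflHolds_box]
    refine ⟨fun hβ hw => ⟨?_, ?_⟩, fun hβ h => by_contra fun hw => h.1 (Or.inl ⟨i, hβ, hw⟩)⟩
    · rintro (h | ⟨γ, h, hγ⟩)
      · exact hc.not_refuted hβ hw h
      · cases h
        exact ((hc.model i).neg _).1 ((hc.model i).sound _ (.rosbox γ hγ)) hw
    · rintro γ rfl
      have hlt : sizeOf γ < sizeOf (ModalForm.box (.boxIter k γ)) := by
        have := ModalForm.sizeOf_le_boxIter k γ
        simp only [ModalForm.box.sizeOf_spec]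
        omega
      refine (ih γ hlt i).1 ((hc.closed i).of_boxIter (Nat.zero_le (k + 1)) hβ) ?_
      exact ((hc.model i).imp _ _).1 ((hc.model i).sound _ (.amn γ)) hw

theorem NpA.of_diag {k l : ℕ} {θ : ModalForm} (h : NpA k k θ) : NpA l l θ := by
  induction h with
  | taut p σ hp => exact .taut p σ hp
  | amn φ =>
    exact .taut (.imp (.var 0) (.var 0)) (fun _ => ModalForm.boxIter k φ)
      (by intro v; simp only [PropForm.eval]; cases v 0 <;> rfl)
  | mp φ ψ _ _ ih₁ ih₂ => exact .mp φ ψ ih₁ ih₂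
  | nec φ _ ih => exact .nec φ ih
  | rosbox φ _ ih => exact .rosbox φ ih

theorem IsModel.of_diag {k l : ℕ} {V : ModalForm → Prop} (h : IsModel k k V) : IsModel l l V :=
  ⟨h.toIsBoolVal, fun θ hθ => h.sound θ hθ.of_diag⟩

theorem Compatible.exists_amalgam {ι : Type} {m n : ℕ} {w : ι → ModalForm → Prop}
    {S : ι → Bool → ModalForm → Prop} (hc : Compatible m n w S) :
    ∃ u, IsModel m n u ∧ ∀ α, Amalgamates u w S α := by
  cases m with
  | succ m => exact hc.exists_amalgam_succ
  | zero =>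
    cases n with
    | succ k => exact hc.exists_amalgam_refl
    | zero =>
      obtain ⟨u, hu, h⟩ := Compatible.exists_amalgam_succ (m := 0) (n := 1) (w := w) (S := S)
        ⟨fun i => (hc.model i).of_diag, hc.closed, hc.compat⟩
      exact ⟨u, hu.of_diag, h⟩

/-! ### Signed subformulas -/

/-- `SignedSub φ b α`: the formula `α` occurs in `φ`, positively or negatively according to `b`. -/
inductive SignedSub (φ : ModalForm) : Bool → ModalForm → Prop
  | self : SignedSub φ true φ
  | and_left (b : Bool) (α β : ModalForm) : SignedSub φ b (.and α β) → SignedSub φ b α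
  | and_right (b : Bool) (α β : ModalForm) : SignedSub φ b (.and α β) → SignedSub φ b β
  | or_left (b : Bool) (α β : ModalForm) : SignedSub φ b (.or α β) → SignedSub φ b α
  | or_right (b : Bool) (α β : ModalForm) : SignedSub φ b (.or α β) → SignedSub φ b β
  | imp_left (b : Bool) (α β : ModalForm) : SignedSub φ b (.imp α β) → SignedSub φ (!b) α
  | imp_right (b : Bool) (α β : ModalForm) : SignedSub φ b (.imp α β) → SignedSub φ b β
  | box (b : Bool) (α : ModalForm) : SignedSub φ b (.box α) → SignedSub φ b α

theorem SignedSub.signedClosed (φ : ModalForm) : SignedClosed (SignedSub φ) where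
  and _ _ _ h := ⟨.and_left _ _ _ h, .and_right _ _ _ h⟩
  or _ _ _ h := ⟨.or_left _ _ _ h, .or_right _ _ _ h⟩
  imp _ _ _ h := ⟨.imp_left _ _ _ h, .imp_right _ _ _ h⟩
  box _ _ h := .box _ _ h

/-- The same signed set with the signs exchanged. -/
theorem SignedClosed.flip {S : Bool → ModalForm → Prop} (hS : SignedClosed S) :
    SignedClosed fun b => S (!b) where
  and b := hS.and !b
  or b := hS.or !b
  imp b := hS.imp !b
  box b := hS.box !b

/-- The finite set of subformulas. -/
def ModalForm.subs : ModalForm → Finset ModalForm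
  | .var i => {.var i}
  | .fls => {.fls}
  | .and α β => insert (.and α β) (α.subs ∪ β.subs)
  | .or α β => insert (.or α β) (α.subs ∪ β.subs)
  | .imp α β => insert (.imp α β) (α.subs ∪ β.subs)
  | .box α => insert (.box α) α.subs

theorem ModalForm.self_mem_subs (α : ModalForm) : α ∈ α.subs := by
  cases α <;> simp [subs]

theorem ModalForm.subs_subset {α β : ModalForm} (h : α ∈ β.subs) : α.subs ⊆ β.subs := by
  induction β with
  | var i => simp_all [subs]
  | fls => simp_all [subs]
  | and β γ ihβ ihγ | or β γ ihβ ihγ | imp β γ ihβ ihγ =>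
    rw [subs, Finset.mem_insert, Finset.mem_union] at h
    rcases h with rfl | h | h
    · rfl
    · exact (ihβ h).trans (Finset.subset_union_left.trans (Finset.subset_insert _ _))
    · exact (ihγ h).trans (Finset.subset_union_right.trans (Finset.subset_insert _ _))
  | box β ih =>
    rw [subs, Finset.mem_insert] at h
    rcases h with rfl | h
    · rfl
    · exact (ih h).trans (Finset.subset_insert _ _)

namespace SignedSub

variable {φ α : ModalForm} {b : Bool}

theorem mem_subs (h : SignedSub φ b α) : α ∈ φ.subs := by
  induction h with
  | self => exact φ.self_mem_subs
  | and_left _ α β _ ih | and_right _ α β _ ih | or_left _ α β _ ih | or_right _ α β _ ih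
  | imp_left _ α β _ ih | imp_right _ α β _ ih | box _ α _ ih =>
    refine ModalForm.subs_subset ih ?_
    simp [ModalForm.subs, ModalForm.self_mem_subs]

theorem Vsgn_subset (h : SignedSub φ b α) (c : Bool) : α.Vsgn c ⊆ φ.Vsgn (b == c) := by
  induction h generalizing c with
  | self => simp
  | and_left b α β _ ih | or_left b α β _ ih =>
    exact Finset.subset_union_left.trans (ih c)
  | and_right b α β _ ih | or_right b α β _ ih | imp_right b α β _ ih =>
    exact Finset.subset_union_right.trans (ih c)
  | imp_left b α β _ ih =>
    have := ih (!c)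
    rw [ModalForm.Vsgn, Bool.not_not] at this
    have hbc : ((!b) == c) = (b == !c) := by cases b <;> cases c <;> rfl
    rw [hbc]
    exact Finset.subset_union_left.trans this
  | box b α _ ih => exact ih c

end SignedSub

theorem ModalForm.Vsgn_neg_s1 (α : ModalForm) (c : Bool) : α.neg.Vsgn c = α.Vsgn !c := by
  simp [neg, Vsgn]

/-! ### The interpolant -/

/-- Disjunction of a list of formulas. -/
def ModalForm.disj : List ModalForm → ModalForm
  | [] => .fls
  | α :: l => .or α (disj l)

/-- Conjunction of a list of formulas. -/
def ModalForm.conj : List ModalForm → ModalForm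
  | [] => .imp .fls .fls
  | α :: l => .and α (conj l)

theorem IsBoolVal.disj {V : ModalForm → Prop} (hV : IsBoolVal V) (l : List ModalForm) :
    V (ModalForm.disj l) ↔ ∃ α ∈ l, V α := by
  induction l with
  | nil => simp [ModalForm.disj, hV.fls]
  | cons α l ih => simp [ModalForm.disj, hV.or, ih]

theorem IsBoolVal.conj {V : ModalForm → Prop} (hV : IsBoolVal V) (l : List ModalForm) :
    V (ModalForm.conj l) ↔ ∀ α ∈ l, V α := by
  induction l with
  | nil => simp [ModalForm.conj, hV.imp]
  | cons α l ih => simp [ModalForm.conj, hV.and, ih]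

theorem ModalForm.Vsgn_disj_subset {l : List ModalForm} {c : Bool} {X : Finset ℕ}
    (h : ∀ α ∈ l, α.Vsgn c ⊆ X) : (disj l).Vsgn c ⊆ X := by
  induction l with
  | nil => simp [disj, Vsgn]
  | cons α l ih =>
    rw [List.forall_mem_cons] at h
    exact Finset.union_subset h.1 (ih h.2)

theorem ModalForm.Vsgn_conj_subset {l : List ModalForm} {c : Bool} {X : Finset ℕ}
    (h : ∀ α ∈ l, α.Vsgn c ⊆ X) : (conj l).Vsgn c ⊆ X := by
  induction l with
  | nil => simp [conj, Vsgn]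
  | cons α l ih =>
    rw [List.forall_mem_cons] at h
    exact Finset.union_subset h.1 (ih h.2)

/-- For a finite list `l` of formulas, the conjunction of all disjunctions over sublists of `l`
implied by `φ` is the strongest consequence of `φ` monotone in `l`. -/
theorem NpA.exists_strongest {m n : ℕ} (φ : ModalForm) (l : List ModalForm) :
    ∃ χ : ModalForm, (∀ c X, (∀ α ∈ l, α.Vsgn c ⊆ X) → χ.Vsgn c ⊆ X) ∧ NpA m n (.imp φ χ) ∧
      ∀ v, IsModel m n v → v χ → ∃ w, IsModel m n w ∧ w φ ∧ ∀ α ∈ l, w α → v α := by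
  classical
  refine ⟨.conj ((l.sublists.filter fun t => NpA m n (.imp φ (.disj t))).map .disj),
    fun c X h => ModalForm.Vsgn_conj_subset ?_, ?_, fun v hv hχ => ?_⟩
  · simp only [List.mem_map, List.mem_filter, List.mem_sublists]
    rintro _ ⟨t, ⟨ht, -⟩, rfl⟩
    exact ModalForm.Vsgn_disj_subset fun α hα => h α (ht.subset hα)
  · by_contra hcon
    obtain ⟨V, hV, hnot⟩ := NpA.exists_model hcon
    rw [hV.imp, hV.conj] at hnot
    refine hnot fun hφ α hα => ?_
    simp only [List.mem_map, List.mem_filter, decide_eq_true_eq] at hα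
    obtain ⟨t, ⟨-, ht⟩, rfl⟩ := hα
    exact (hV.imp _ _).1 (hV.sound _ ht) hφ
  · by_cases ht : NpA m n (.imp φ (.disj (l.filter fun α => ¬ v α)))
    · rw [hv.conj] at hχ
      have := hχ _ (List.mem_map.2 ⟨_, List.mem_filter.2
        ⟨List.mem_sublists.2 List.filter_sublist, decide_eq_true ht⟩, rfl⟩)
      obtain ⟨α, hα, hvα⟩ := (hv.disj _).1 this
      simp [hvα] at hα
    · obtain ⟨w, hw, hnot⟩ := NpA.exists_model ht
      rw [hw.imp, hw.disj] at hnot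
      push Not at hnot
      refine ⟨w, hw, hnot.1, fun α hα hwα => by_contra fun hvα => hnot.2 α ?_ hwα⟩
      simp [hα, hvα]

/-- NpA enjoys the uniform Lyndon interpolation property. -/
theorem NpA_ULIP (m n : ℕ) (φ : ModalForm) (Pp Pm : Finset ℕ) :
    ∃ χ : ModalForm,
      χ.Vpos ⊆ φ.Vpos \ Pp ∧ χ.Vneg ⊆ φ.Vneg \ Pm ∧
      NpA m n (.imp φ χ) ∧
      ∀ ψ : ModalForm, NpA m n (.imp φ ψ) →
        ψ.Vpos ∩ Pp = ∅ → ψ.Vneg ∩ Pm = ∅ → NpA m n (.imp χ ψ) := by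
  classical
  set L : Finset ModalForm := (φ.subs ∪ φ.subs.image ModalForm.neg).filter fun α =>
    α.Vsgn true ⊆ φ.Vsgn true \ Pp ∧ α.Vsgn false ⊆ φ.Vsgn false \ Pm
  obtain ⟨χ, hV, hφχ, hχ⟩ := NpA.exists_strongest (m := m) (n := n) φ L.toList
  refine ⟨χ, hV true _ fun α hα => ?_, hV false _ fun α hα => ?_, hφχ, fun ψ hψ hp hm => ?_⟩
  · exact (Finset.mem_filter.1 (Finset.mem_toList.1 hα)).2.1
  · exact (Finset.mem_filter.1 (Finset.mem_toList.1 hα)).2.2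
  by_contra hcon
  obtain ⟨v, hv, hnot⟩ := NpA.exists_model hcon
  rw [hv.imp, Classical.not_imp] at hnot
  obtain ⟨w, hw, hwφ, hwv⟩ := hχ v hv hnot.1
  have hmem : ∀ α, α ∈ φ.subs ∪ φ.subs.image ModalForm.neg →
      (∀ c, α.Vsgn c ⊆ φ.Vsgn c ∧ α.Vsgn c ⊆ ψ.Vsgn c) → w α → v α := by
    intro α hα hsub
    refine hwv α (Finset.mem_toList.2 (Finset.mem_filter.2 ⟨hα, ?_, ?_⟩))
    · exact Finset.subset_sdiff.2 ⟨(hsub true).1,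
        (Finset.disjoint_iff_inter_eq_empty.2 hp).mono_left (hsub true).2⟩
    · exact Finset.subset_sdiff.2 ⟨(hsub false).1,
        (Finset.disjoint_iff_inter_eq_empty.2 hm).mono_left (hsub false).2⟩
  have hpos : ∀ α, SignedSub φ true α → SignedSub ψ true α → w α → v α := fun α hα hβ =>
    hmem α (Finset.mem_union_left _ hα.mem_subs)
      fun c => ⟨by simpa using hα.Vsgn_subset c, by simpa using hβ.Vsgn_subset c⟩
  have hneg : ∀ α, SignedSub φ false α → SignedSub ψ false α → v α → w α := by
    intro α hα hβ hvα
    by_contra hwα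
    refine (hv.neg α).1 (hmem α.neg (Finset.mem_union_right _
      (Finset.mem_image_of_mem _ hα.mem_subs)) (fun c => ?_) ((hw.neg α).2 hwα)) hvα
    rw [ModalForm.Vsgn_neg_s1]
    exact ⟨by simpa using hα.Vsgn_subset !c, by simpa using hβ.Vsgn_subset !c⟩
  have hc : Compatible m n (fun i : Bool => if i then w else v)
      (fun i b => if i then SignedSub φ b else SignedSub ψ !b) := by
    refine ⟨?_, ?_, ?_⟩
    · rintro (_ | _)
      exacts [hv, hw]
    · rintro (_ | _)
      exacts [(SignedSub.signedClosed ψ).flip, SignedSub.signedClosed φ]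
    · rintro (_ | _) (_ | _) α h₁ h₂ h₃
      exacts [h₃, hneg α h₂ h₁ h₃, hpos α h₁ h₂ h₃, h₃]
  obtain ⟨u, hu, ham⟩ := hc.exists_amalgam
  have huφ : u φ := (ham φ true).1 SignedSub.self hwφ
  have huψ : u ψ := (hu.imp _ _).1 (hu.sound _ hψ) huφ
  exact hnot.2 ((ham ψ false).2 SignedSub.self huψ)
end

section
/- For all natural numbers m and n, the logic NRAmn enjoys the uniform Lyndon interpolation property (ULIP): for every modal formula φ and all finite sets P⁺, P⁻ of propositional variables, there exists a modal formula χ such that V^•(χ) ⊆ V^•(φ) \ P^• for each • ∈ {+,−}, NRAmn ⊢ φ → χ, and NRAmn ⊢ χ → ψ for every modal formula ψ such that NRAmn ⊢ φ → ψ and V^•(ψ) ∩ P^• = ∅ for each • ∈ {+,−}. -/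
/-- The logic NRAmn = NAmn + (Ros : from ¬φ infer ¬□φ). -/
inductive NRA (m n : ℕ) : ModalForm → Prop
  | taut (p : PropForm) (σ : ℕ → ModalForm) : p.Taut → NRA m n (p.subst σ)
  | amn (φ : ModalForm) : NRA m n (.imp (ModalForm.boxIter n φ) (ModalForm.boxIter m φ))
  | mp (φ ψ : ModalForm) : NRA m n (.imp φ ψ) → NRA m n φ → NRA m n ψ
  | nec (φ : ModalForm) : NRA m n φ → NRA m n (.box φ)
  | ros (φ : ModalForm) : NRA m n (ModalForm.neg φ) → NRA m n (ModalForm.neg (.box φ))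

namespace ModalForm

/-- The list of subformulas of a modal formula. -/
def subs_s2 : ModalForm → List ModalForm
  | .var i => [.var i]
  | .fls => [.fls]
  | .and φ ψ => .and φ ψ :: (φ.subs_s2 ++ ψ.subs_s2)
  | .or φ ψ => .or φ ψ :: (φ.subs_s2 ++ ψ.subs_s2)
  | .imp φ ψ => .imp φ ψ :: (φ.subs_s2 ++ ψ.subs_s2)
  | .box φ => .box φ :: φ.subs_s2

theorem self_mem_subs_s2 (φ : ModalForm) : φ ∈ φ.subs_s2 := by
  cases φ <;> simp [subs_s2]

theorem subs_subset_of_mem {α φ : ModalForm} (h : α ∈ φ.subs_s2) : α.subs_s2 ⊆ φ.subs_s2 := by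
  induction φ with
  | var i => simp only [subs_s2, List.mem_singleton] at h; subst h; exact List.Subset.refl _
  | fls => simp only [subs_s2, List.mem_singleton] at h; subst h; exact List.Subset.refl _
  | and φ ψ ih₁ ih₂ | or φ ψ ih₁ ih₂ | imp φ ψ ih₁ ih₂ =>
    simp only [subs_s2, List.mem_cons, List.mem_append] at h
    rcases h with rfl | h | h
    · exact List.Subset.refl _
    · intro x hx; simp [subs_s2, ih₁ h hx]
    · intro x hx; simp [subs_s2, ih₂ h hx]
  | box φ ih =>
    simp only [subs_s2, List.mem_cons] at h
    rcases h with rfl | h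
    · exact List.Subset.refl _
    · intro x hx; simp [subs_s2, ih h hx]

theorem sizeOf_le_boxIter_s2 (k : ℕ) (α : ModalForm) : sizeOf α ≤ sizeOf (boxIter k α) := by
  induction k with
  | zero => exact le_rfl
  | succ k ih => simp only [boxIter, box.sizeOf_spec]; omega

/-- A valuation of modal formulas that treats boxed formulas as atoms. -/
structure IsVal (v : ModalForm → Bool) : Prop where
  fls : v .fls = false
  and : ∀ α β, v (.and α β) = (v α && v β)
  or : ∀ α β, v (.or α β) = (v α || v β)
  imp : ∀ α β, v (.imp α β) = (!v α || v β)

theorem IsVal.neg {v : ModalForm → Bool} (hv : IsVal v) (α : ModalForm) :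
    v α.neg = !v α := by
  simp [ModalForm.neg, hv.imp, hv.fls]

theorem IsVal.subst {v : ModalForm → Bool} (hv : IsVal v) (σ : ℕ → ModalForm) (p : PropForm) :
    v (p.subst σ) = p.eval (fun i => v (σ i)) := by
  induction p with
  | var i => rfl
  | fls => exact hv.fls
  | and p q ihp ihq => simp [PropForm.subst, PropForm.eval, hv.and, ihp, ihq]
  | or p q ihp ihq => simp [PropForm.subst, PropForm.eval, hv.or, ihp, ihq]
  | imp p q ihp ihq => simp [PropForm.subst, PropForm.eval, hv.imp, ihp, ihq]

/-- A valuation that makes all theorems of `NRA m n` true. -/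
def IsModel (m n : ℕ) (v : ModalForm → Bool) : Prop :=
  IsVal v ∧ ∀ γ, NRA m n γ → v γ = true

/-- A class of valuations that satisfies the modal reduction principle and contains a witness for every
value of a boxed formula consists of models. -/
theorem isModel_of_class {m n : ℕ} (C : (ModalForm → Bool) → Prop)
    (hval : ∀ v, C v → IsVal v)
    (hA : ∀ v, C v → ∀ α, v (boxIter n α) = true → v (boxIter m α) = true)
    (hbox : ∀ v, C v → ∀ β, ∃ v', C v' ∧ v' β = v (.box β))
    {v : ModalForm → Bool} (hv : C v) : IsModel m n v := by
  refine ⟨hval v hv, fun γ hγ => ?_⟩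
  induction hγ generalizing v with
  | taut p σ hp => rw [(hval v hv).subst]; exact hp _
  | amn φ =>
    have := hA v hv φ
    rw [(hval v hv).imp]
    cases h : v (boxIter n φ) <;> simp_all
  | mp φ ψ _ _ ih₁ ih₂ =>
    have h₁ := ih₁ hv
    rw [(hval v hv).imp, ih₂ hv] at h₁
    simpa using h₁
  | nec φ _ ih =>
    obtain ⟨v', hv', h⟩ := hbox v hv φ
    rw [← h]; exact ih hv'
  | ros φ _ ih =>
    obtain ⟨v', hv', h⟩ := hbox v hv φ
    have h' := ih hv'
    rw [(hval v' hv').neg] at h'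
    rw [(hval v hv).neg, ← h, h']

theorem exists_isModel (m n : ℕ) : ∃ v, IsModel m n v := by
  let f : ModalForm → Bool := fun φ => ModalForm.rec (motive := fun _ => Bool)
    (fun _ => true) false (fun _ _ a b => a && b) (fun _ _ a b => a || b)
    (fun _ _ a b => !a || b) (fun _ a => a) φ
  have hf : ∀ k α, f (boxIter k α) = f α := by
    intro k α
    induction k with
    | zero => rfl
    | succ k ih => exact ih
  refine ⟨f, isModel_of_class (fun v => v = f) ?_ ?_ ?_ rfl⟩
  · rintro v rfl
    exact ⟨rfl, fun _ _ => rfl, fun _ _ => rfl, fun _ _ => rfl⟩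
  · rintro v rfl α h
    rwa [hf] at h ⊢
  · rintro v rfl β
    exact ⟨f, rfl, rfl⟩

section Completeness

variable {m n : ℕ}

/-- `T` contains all theorems and is closed under modus ponens. -/
def IsTheory (m n : ℕ) (T : Set ModalForm) : Prop :=
  (∀ γ, NRA m n γ → γ ∈ T) ∧ ∀ α β, .imp α β ∈ T → α ∈ T → β ∈ T

theorem exists_maximal_theory {γ : ModalForm} (h : ¬ NRA m n γ) :
    ∃ T, Maximal (fun T => IsTheory m n T ∧ γ ∉ T) T := by
  obtain ⟨T, -, hT⟩ := zorn_subset_nonempty {T | IsTheory m n T ∧ γ ∉ T} (fun c hc hch hne => by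
    refine ⟨⋃₀ c, ⟨⟨fun δ hδ => ?_, ?_⟩, ?_⟩, fun s hs => Set.subset_sUnion_of_mem hs⟩
    · obtain ⟨s, hs⟩ := hne
      exact ⟨s, hs, (hc hs).1.1 δ hδ⟩
    · rintro α β ⟨s, hs, h₁⟩ ⟨t, ht, h₂⟩
      rcases hch.total hs ht with hst | hts
      · exact ⟨t, ht, (hc ht).1.2 α β (hst h₁) h₂⟩
      · exact ⟨s, hs, (hc hs).1.2 α β h₁ (hts h₂)⟩
    · rintro ⟨s, hs, h₁⟩
      exact (hc hs).2 h₁) {δ | NRA m n δ} ⟨⟨fun _ h => h, fun α β => NRA.mp α β⟩, h⟩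
  exact ⟨T, hT⟩

/-- Completeness: a formula true in all models is a theorem. -/
theorem NRA_of_forall_isModel {γ : ModalForm} (h : ∀ v, IsModel m n v → v γ = true) :
    NRA m n γ := by
  classical
  by_contra hγ
  obtain ⟨T, hT⟩ := exists_maximal_theory hγ
  obtain ⟨⟨⟨hthm, hmp⟩, hγT⟩, hmax⟩ := hT
  have taut : ∀ (p : PropForm) (a b c : ModalForm), p.Taut →
      (p.subst fun i => if i = 0 then a else if i = 1 then b else c) ∈ T :=
    fun p a b c hp => hthm _ (NRA.taut p _ hp)
  have hK : ∀ a b, b ∈ T → .imp a b ∈ T := fun a b hb =>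
    hmp _ _ (taut (.imp (.var 1) (.imp (.var 0) (.var 1))) a b b (by
      intro v; simp only [PropForm.eval]; cases v 0 <;> cases v 1 <;> rfl)) hb
  have hneg : ∀ a, a ∉ T → .imp a γ ∈ T := by
    intro a ha
    by_contra hc
    refine ha (hmax (y := {b | ModalForm.imp a b ∈ T}) ⟨⟨fun δ hδ => hK _ _ (hthm δ hδ), ?_⟩, hc⟩
      (fun b hb => hK a b hb) ?_)
    · intro α β h₁ h₂
      exact hmp _ _ (hmp _ _ (taut (.imp (.imp (.var 0) (.imp (.var 1) (.var 2)))
        (.imp (.imp (.var 0) (.var 1)) (.imp (.var 0) (.var 2)))) a α β (by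
          intro v; simp only [PropForm.eval]; cases v 0 <;> cases v 1 <;> cases v 2 <;> rfl))
        h₁) h₂
    · exact taut (.imp (.var 0) (.var 0)) a a a (by
        intro v; simp only [PropForm.eval]; cases v 0 <;> rfl)
  have hfls : ModalForm.fls ∉ T := fun hf => hγT (hmp _ _ (taut (.imp .fls (.var 0)) γ γ γ (by
    intro v; simp [PropForm.eval])) hf)
  have hand : ∀ a b, .and a b ∈ T ↔ a ∈ T ∧ b ∈ T := by
    intro a b
    refine ⟨fun hab => ⟨?_, ?_⟩, fun hab => ?_⟩
    · exact hmp _ _ (taut (.imp (.and (.var 0) (.var 1)) (.var 0)) a b b (by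
        intro v; simp only [PropForm.eval]; cases v 0 <;> cases v 1 <;> rfl)) hab
    · exact hmp _ _ (taut (.imp (.and (.var 0) (.var 1)) (.var 1)) a b b (by
        intro v; simp only [PropForm.eval]; cases v 0 <;> cases v 1 <;> rfl)) hab
    · exact hmp _ _ (hmp _ _ (taut (.imp (.var 0) (.imp (.var 1) (.and (.var 0) (.var 1)))) a b b (by
        intro v; simp only [PropForm.eval]; cases v 0 <;> cases v 1 <;> rfl)) hab.1) hab.2
  have hor : ∀ a b, .or a b ∈ T ↔ a ∈ T ∨ b ∈ T := by
    intro a b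
    refine ⟨fun hab => ?_, fun hab => ?_⟩
    · by_contra hc
      rw [not_or] at hc
      exact hγT (hmp _ _ (hmp _ _ (hmp _ _ (taut (.imp (.imp (.var 0) (.var 2))
        (.imp (.imp (.var 1) (.var 2)) (.imp (.or (.var 0) (.var 1)) (.var 2)))) a b γ (by
          intro v; simp only [PropForm.eval]; cases v 0 <;> cases v 1 <;> cases v 2 <;> rfl))
        (hneg a hc.1)) (hneg b hc.2)) hab)
    · rcases hab with ha | hb
      · exact hmp _ _ (taut (.imp (.var 0) (.or (.var 0) (.var 1))) a b b (by
          intro v; simp only [PropForm.eval]; cases v 0 <;> cases v 1 <;> rfl)) ha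
      · exact hmp _ _ (taut (.imp (.var 1) (.or (.var 0) (.var 1))) a b b (by
          intro v; simp only [PropForm.eval]; cases v 0 <;> cases v 1 <;> rfl)) hb
  have himp : ∀ a b, .imp a b ∈ T ↔ (a ∈ T → b ∈ T) := by
    intro a b
    refine ⟨fun hab ha => hmp a b hab ha, fun hab => ?_⟩
    by_cases ha : a ∈ T
    · exact hK a b (hab ha)
    · by_contra hc
      exact hγT (hmp _ _ (hmp _ _ (taut (.imp (.imp (.var 0) (.var 2))
        (.imp (.imp (.imp (.var 0) (.var 1)) (.var 2)) (.var 2))) a b γ (by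
          intro v; simp only [PropForm.eval]; cases v 0 <;> cases v 1 <;> cases v 2 <;> rfl))
        (hneg a ha)) (hneg _ hc))
  have := h (fun a => decide (a ∈ T)) ⟨⟨by simp [hfls], by simp [hand], by simp [hor], by
    intro a b
    by_cases ha : a ∈ T <;> by_cases hb : b ∈ T <;> simp [himp, ha, hb]⟩,
    fun δ hδ => by simpa using hthm δ hδ⟩
  exact hγT (by simpa using this)

end Completeness

variable {m n : ℕ}

theorem IsModel.boxIter_true {v : ModalForm → Bool} (hv : IsModel m n v) {α : ModalForm}
    (h : v (boxIter n α) = true) : v (boxIter m α) = true := by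
  have hamn := hv.2 _ (NRA.amn α)
  rw [hv.1.imp, h] at hamn
  simpa using hamn

/-- Some model gives `β` the value `b`. -/
def Realizable (m n : ℕ) (b : Bool) (β : ModalForm) : Prop :=
  ∃ v, IsModel m n v ∧ v β = b

theorem IsModel.realizable_box {v : ModalForm → Bool} (hv : IsModel m n v) (β : ModalForm) :
    Realizable m n (v (.box β)) β := by
  by_contra hc
  simp only [Realizable, not_exists, not_and] at hc
  cases h : v (.box β) with
  | true =>
    have h' := hv.2 _ (NRA.ros β (NRA_of_forall_isModel fun v' hv' => by
      rw [hv'.1.neg]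
      simpa [h] using hc v' hv'))
    rw [hv.1.neg, h] at h'
    cases h'
  | false =>
    have h' := hv.2 _ (NRA.nec β (NRA_of_forall_isModel fun v' hv' => by
      simpa [h] using hc v' hv'))
    rw [h] at h'
    cases h'

theorem realizable_of_not_not {s : Bool} {β : ModalForm} (h : ¬ Realizable m n (!s) β) :
    Realizable m n s β := by
  obtain ⟨v, hv⟩ := exists_isModel m n
  refine ⟨v, hv, ?_⟩
  by_contra hc
  exact h ⟨v, hv, by cases s <;> simpa using hc⟩

theorem isModel_of_realizable {v : ModalForm → Bool} (hv : IsVal v)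
    (hA : ∀ α, v (boxIter n α) = true → v (boxIter m α) = true)
    (hbox : ∀ β, Realizable m n (v (.box β)) β) : IsModel m n v := by
  refine isModel_of_class (fun v' => IsModel m n v' ∨ v' = v) ?_ ?_ ?_ (Or.inr rfl)
  · rintro v' (h | rfl)
    exacts [h.1, hv]
  · rintro v' (h | rfl) α
    exacts [h.boxIter_true, hA α]
  · rintro v' (h | rfl) β
    · obtain ⟨v'', h₁, h₂⟩ := h.realizable_box β
      exact ⟨v'', Or.inl h₁, h₂⟩
    · obtain ⟨v'', h₁, h₂⟩ := hbox β
      exact ⟨v'', Or.inl h₁, h₂⟩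

section Build

open Classical in
/-- The valuation giving `□β` the value `s` exactly when `base β` holds or `β` is of the form
`□^k α` with `α` of value `s`. -/
noncomputable def build (s : Bool) (k : ℕ) (f : ℕ → Bool) (base : ModalForm → Prop) :
    ModalForm → Bool
  | .var i => f i
  | .fls => false
  | .and α β => build s k f base α && build s k f base β
  | .or α β => build s k f base α || build s k f base β
  | .imp α β => !build s k f base α || build s k f base β
  | .box β =>
    if base β ∨ ∃ α, ∃ _ : β = boxIter k α, build s k f base α = s then s else !s
termination_by φ => sizeOf φ
decreasing_by
  all_goals first
    | (simp only [and.sizeOf_spec, or.sizeOf_spec, imp.sizeOf_spec]; omega)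
    | (subst_vars; have := sizeOf_le_boxIter_s2 k α; simp only [box.sizeOf_spec]; omega)

variable {s : Bool} {k : ℕ} {f : ℕ → Bool} {base : ModalForm → Prop}

theorem isVal_build : IsVal (build s k f base) :=
  ⟨by simp [build], by simp [build], by simp [build], by simp [build]⟩

theorem build_var (i : ℕ) : build s k f base (.var i) = f i := by simp [build]

theorem build_box_eq (β : ModalForm) : build s k f base (.box β) = s ↔
    base β ∨ ∃ α, β = boxIter k α ∧ build s k f base α = s := by
  rw [build]
  simp_rw [← exists_prop (a := β = _)]
  split_ifs with h
  · exact iff_of_true rfl h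
  · exact iff_of_false (by simp) h

theorem build_boxIter {α : ModalForm} (h : build s k f base α = s) :
    build s k f base (boxIter (k + 1) α) = s := by
  rw [boxIter, build_box_eq]
  exact Or.inr ⟨α, rfl, h⟩

end Build

/-- For valuations, the modal reduction principle of `NRA m n` says that the value `s` propagates from `α` to
`□^(k+1) α`. -/
def Propagates (m n : ℕ) (s : Bool) (k : ℕ) : Prop :=
  ∀ v : ModalForm → Bool, (∀ α, v (boxIter n α) = true → v (boxIter m α) = true) ↔
    ∀ α, v α = s → v (boxIter (k + 1) α) = s

theorem propagates_true (k : ℕ) : Propagates (k + 1) 0 true k := fun _ => Iff.rfl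

theorem propagates_false (k : ℕ) : Propagates 0 (k + 1) false k := by
  intro v
  refine forall_congr' fun α => ?_
  change (v (boxIter (k + 1) α) = true → v α = true) ↔ _
  cases v α <;> cases v (boxIter (k + 1) α) <;> simp

theorem IsModel.propagate {s : Bool} {k : ℕ} (hp : Propagates m n s k)
    {v : ModalForm → Bool} (hv : IsModel m n v) {α : ModalForm} (h : v α = s) :
    v (boxIter (k + 1) α) = s :=
  (hp v).1 (fun _ => hv.boxIter_true) α h

/-- Valuations whose boxed values `s` are realizable or inherited from a tower of boxes. -/
structure TowerVal (m n : ℕ) (s : Bool) (k : ℕ) (v : ModalForm → Bool) : Prop where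
  val : IsVal v
  propagate : ∀ α, v α = s → v (boxIter (k + 1) α) = s
  realizable_not : ∀ β, v (.box β) = !s → Realizable m n (!s) β
  realizable_or : ∀ β, v (.box β) = s →
    Realizable m n s β ∨ ∃ i α, β = boxIter i α ∧ v α = s

theorem IsModel.towerVal {s : Bool} {k : ℕ} (hp : Propagates m n s k)
    {v : ModalForm → Bool} (hv : IsModel m n v) : TowerVal m n s k v where
  val := hv.1
  propagate _ h := hv.propagate hp h
  realizable_not β h := h ▸ hv.realizable_box β
  realizable_or β h := Or.inl (h ▸ hv.realizable_box β)

theorem TowerVal.exists_boxIter {s : Bool} {k : ℕ} {v : ModalForm → Bool}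
    (hv : TowerVal m n s k v) {α : ModalForm} (hα : v α = s) (i : ℕ) :
    ∃ v', TowerVal m n s k v' ∧ v' (boxIter i α) = s := by
  let base : ModalForm → Prop := fun β =>
    if sizeOf (ModalForm.box β) ≤ sizeOf α then v (.box β) = s
    else ¬ Realizable m n (!s) β ∨ ∃ j, β = boxIter j α
  let v' := build s k (fun i => v (.var i)) base
  have hval : IsVal v' := isVal_build
  have hbox : ∀ β, v' (.box β) = s ↔ base β ∨ ∃ α, β = boxIter k α ∧ v' α = s := build_box_eq
  have hagree : ∀ N, ∀ γ : ModalForm, sizeOf γ ≤ N → sizeOf γ ≤ sizeOf α → v' γ = v γ := by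
    intro N
    induction N with
    | zero => intro γ h; cases γ <;> simp at h
    | succ N ih =>
      intro γ h h'
      cases γ with
      | var i => exact build_var i
      | fls => rw [hval.fls, hv.val.fls]
      | and a b | or a b | imp a b =>
        simp only [and.sizeOf_spec, or.sizeOf_spec, imp.sizeOf_spec] at h h'
        simp only [hval.and, hv.val.and, hval.or, hv.val.or, hval.imp, hv.val.imp]
        rw [ih a (by omega) (by omega), ih b (by omega) (by omega)]
      | box β =>
        have key : v' (.box β) = s ↔ v (.box β) = s := by
          rw [hbox]
          simp only [base, if_pos h']
          refine ⟨?_, Or.inl⟩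
          rintro (h₁ | ⟨δ, rfl, h₁⟩)
          · exact h₁
          · have := sizeOf_le_boxIter_s2 k δ
            simp only [box.sizeOf_spec] at h h'
            rw [ih δ (by omega) (by omega)] at h₁
            exact hv.propagate δ h₁
        revert key
        cases v' (.box β) <;> cases v (.box β) <;> cases s <;> simp
  have hag : ∀ γ : ModalForm, sizeOf γ ≤ sizeOf α → v' γ = v γ := fun γ => hagree _ γ le_rfl
  refine ⟨v', ⟨hval, fun _ => build_boxIter, ?_, ?_⟩, ?_⟩
  · intro β h
    have hb : ¬ base β := fun hb => by
      have := (hbox β).2 (Or.inl hb)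
      rw [h] at this
      cases s <;> simp at this
    by_cases hs : sizeOf (ModalForm.box β) ≤ sizeOf α
    · exact hv.realizable_not β (by rw [← hag _ hs, h])
    · simp only [base, if_neg hs, not_or, not_not] at hb
      exact hb.1
  · intro β h
    by_cases hs : sizeOf (ModalForm.box β) ≤ sizeOf α
    · rw [hag _ hs] at h
      refine (hv.realizable_or β h).imp_right ?_
      rintro ⟨j, δ, rfl, hδ⟩
      refine ⟨j, δ, rfl, ?_⟩
      rw [hag, hδ]
      have := sizeOf_le_boxIter_s2 j δ
      simp only [box.sizeOf_spec] at hs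
      omega
    · rcases (hbox β).1 h with hb | ⟨δ, h₁, h₂⟩
      · simp only [base, if_neg hs] at hb
        rcases hb with hb | ⟨j, hj⟩
        · exact Or.inl (realizable_of_not_not hb)
        · exact Or.inr ⟨j, α, hj, by rw [hag α le_rfl, hα]⟩
      · exact Or.inr ⟨k, δ, h₁, h₂⟩
  · cases i with
    | zero =>
      change v' α = s
      rw [hag α le_rfl, hα]
    | succ i =>
      refine (hbox _).2 (Or.inl ?_)
      have := sizeOf_le_boxIter_s2 i α
      simp only [base, box.sizeOf_spec]
      rw [if_neg (by omega)]
      exact Or.inr ⟨i, rfl⟩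

theorem TowerVal.isModel {s : Bool} {k : ℕ} (hp : Propagates m n s k)
    {v : ModalForm → Bool} (hv : TowerVal m n s k v) : IsModel m n v := by
  refine isModel_of_class (TowerVal m n s k) (fun v h => h.val)
    (fun v h => (hp v).2 h.propagate) (fun v h β => ?_) hv
  have real : ∀ b, Realizable m n b β → ∃ v', TowerVal m n s k v' ∧ v' β = b :=
    fun b ⟨v', h₁, h₂⟩ => ⟨v', h₁.towerVal hp, h₂⟩
  by_cases hs : v (.box β) = s
  · rw [hs]
    rcases h.realizable_or β hs with h' | ⟨i, α, rfl, hα⟩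
    · exact real s h'
    · exact h.exists_boxIter hα i
  · have hnot : v (.box β) = !s := by revert hs; cases v (.box β) <;> cases s <;> simp
    rw [hnot]
    exact real _ (h.realizable_not β hnot)

/-- A family of formulas for each sign that is closed under signed immediate subformulas. -/
structure SignClosed (S : Bool → ModalForm → Prop) : Prop where
  and : ∀ b α β, S b (.and α β) → S b α ∧ S b β
  or : ∀ b α β, S b (.or α β) → S b α ∧ S b β
  imp : ∀ b α β, S b (.imp α β) → S (!b) α ∧ S b β
  box : ∀ b α, S b (.box α) → S b α

theorem SignClosed.boxIter {S : Bool → ModalForm → Prop} (hS : SignClosed S) (b : Bool)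
    (k : ℕ) (α : ModalForm) (h : S b (boxIter k α)) : S b α := by
  induction k with
  | zero => exact h
  | succ k ih => exact ih (hS.box _ _ h)

/-- `v` preserves the values `b` that `u` gives to the formulas of sign `b`. -/
def Preserves (S : Bool → ModalForm → Prop) (u v : ModalForm → Bool) (α : ModalForm) : Prop :=
  ∀ b, S b α → u α = b → v α = b

theorem preserves_of_atoms {S : Bool → ModalForm → Prop} (hS : SignClosed S)
    {u v : ModalForm → Bool} (hu : IsVal u) (hv : IsVal v) {N : ℕ}
    (hvar : ∀ i, Preserves S u v (.var i))
    (hbox : ∀ β, sizeOf (ModalForm.box β) ≤ N → Preserves S u v (.box β)) :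
    ∀ α : ModalForm, sizeOf α ≤ N → Preserves S u v α := by
  intro α
  induction α with
  | var i => exact fun _ => hvar i
  | fls => intro _ b _ h; rw [hv.fls, ← h, hu.fls]
  | box β _ => exact hbox β
  | and α β ihα ihβ =>
    intro hN b hSb h
    simp only [and.sizeOf_spec] at hN
    have hα := ihα (by omega) b (hS.and b α β hSb).1
    have hβ := ihβ (by omega) b (hS.and b α β hSb).2
    rw [hu.and] at h
    rw [hv.and]
    revert hα hβ h
    cases b <;> cases u α <;> cases u β <;> cases v α <;> cases v β <;> simp
  | or α β ihα ihβ =>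
    intro hN b hSb h
    simp only [or.sizeOf_spec] at hN
    have hα := ihα (by omega) b (hS.or b α β hSb).1
    have hβ := ihβ (by omega) b (hS.or b α β hSb).2
    rw [hu.or] at h
    rw [hv.or]
    revert hα hβ h
    cases b <;> cases u α <;> cases u β <;> cases v α <;> cases v β <;> simp
  | imp α β ihα ihβ =>
    intro hN b hSb h
    simp only [imp.sizeOf_spec] at hN
    have hα := ihα (by omega) (!b) (hS.imp b α β hSb).1
    have hβ := ihβ (by omega) b (hS.imp b α β hSb).2
    rw [hu.imp] at h
    rw [hv.imp]
    revert hα hβ h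
    cases b <;> cases u α <;> cases u β <;> cases v α <;> cases v β <;> simp

/-- Two models can be amalgamated along signed families of formulas. -/
def Amalgamates (m n : ℕ) (S F : Bool → ModalForm → Prop) (u w : ModalForm → Bool) : Prop :=
  ∃ v, IsModel m n v ∧ (∀ α, Preserves S u v α) ∧ ∀ α, Preserves F v w α

section Amalgamation

variable {S F : Bool → ModalForm → Prop} {u w : ModalForm → Bool}

theorem amalgamates_of_propagates {s : Bool} {k : ℕ} (hp : Propagates m n s k)
    (hS : SignClosed S) (hF : SignClosed F) (hu : IsModel m n u) (hw : IsModel m n w)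
    (hagree : ∀ b α, S b α → F b α → u α = b → w α = b) : Amalgamates m n S F u w := by
  classical
  let low : ModalForm → Prop := fun a => (S s a ∧ u a = s) ∨ (F (!s) a ∧ w a = s)
  let base : ModalForm → Prop := fun β => low (.box β) ∨ ¬ Realizable m n (!s) β
  let v := build s k (fun i => if low (.var i) then s else !s) base
  have hval : IsVal v := isVal_build
  have hbox : ∀ β, v (.box β) = s ↔ base β ∨ ∃ α, β = boxIter k α ∧ v α = s := build_box_eq
  have hvar : ∀ i, v (.var i) = s ↔ low (.var i) := by
    intro i
    simp only [v, build_var]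
    split_ifs with h <;> simp [h]
  have not_low : ∀ a, (S (!s) a ∧ u a = !s) ∨ (F s a ∧ w a = !s) → ¬ low a := by
    intro a ha hl
    have h₁ := hagree s a
    have h₂ := hagree (!s) a
    revert ha hl h₁ h₂
    simp only [low]
    cases s <;> cases u a <;> cases w a <;> simp <;> tauto
  have step : ∀ a, (low a → v a = s) →
      ((S (!s) a ∧ u a = !s) ∨ (F s a ∧ w a = !s) → v a = !s) →
      Preserves S u v a ∧ Preserves F v w a := by
    intro a h₁ h₂
    simp only [low] at h₁
    unfold Preserves
    revert h₁ h₂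
    cases s <;> cases u a <;> cases w a <;> cases v a <;> simp
  have hne : ∀ a, ¬ v a = s → v a = !s := by
    intro a; cases v a <;> cases s <;> simp
  have ne_of : ∀ b : Bool, b = s → ¬ b = !s := by
    intro b; cases b <;> cases s <;> simp
  have pvar : ∀ i, Preserves S u v (.var i) ∧ Preserves F v w (.var i) := fun i =>
    step _ (hvar i).2 fun h => hne _ fun h' => not_low _ h ((hvar i).1 h')
  have pbox : ∀ N, ∀ β, sizeOf (ModalForm.box β) ≤ N →
      Preserves S u v (.box β) ∧ Preserves F v w (.box β) := by
    intro N
    induction N with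
    | zero => intro β h; simp at h
    | succ N ih =>
      intro β hN
      refine step _ (fun h => (hbox β).2 (Or.inl (Or.inl h))) fun h => hne _ fun h' => ?_
      rcases (hbox β).1 h' with (hl | hr) | ⟨α, rfl, hα⟩
      · exact not_low _ h hl
      · rcases h with ⟨-, h⟩ | ⟨-, h⟩
        · exact hr (h ▸ hu.realizable_box β)
        · exact hr (h ▸ hw.realizable_box β)
      · have hsz := sizeOf_le_boxIter_s2 k α
        simp only [box.sizeOf_spec] at hN
        have pS := preserves_of_atoms hS hu.1 hval (fun i => (pvar i).1)
          (fun β hβ => (ih β hβ).1) α (by omega)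
        have pF := preserves_of_atoms hF hval hw.1 (fun i => (pvar i).2)
          (fun β hβ => (ih β hβ).2) α (by omega)
        rcases h with ⟨h₁, h₂⟩ | ⟨h₁, h₂⟩
        · have huα : u α = !s := by
            by_contra hc
            refine ne_of _ (hu.propagate hp (α := α) ?_) h₂
            revert hc; cases u α <;> cases s <;> simp
          exact ne_of _ hα (pS (!s) (hS.boxIter _ (k + 1) α h₁) huα)
        · exact ne_of _ (hw.propagate hp (pF s (hF.boxIter _ (k + 1) α h₁) hα)) h₂
  have hmodel : TowerVal m n s k v := by
    refine ⟨hval, fun _ => build_boxIter, fun β h => ?_, fun β h => ?_⟩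
    · by_contra hc
      exact ne_of _ ((hbox β).2 (Or.inl (Or.inr hc))) h
    · rcases (hbox β).1 h with ((⟨-, h'⟩ | ⟨-, h'⟩) | h') | ⟨α, h₁, h₂⟩
      · exact Or.inl (h' ▸ hu.realizable_box β)
      · exact Or.inl (h' ▸ hw.realizable_box β)
      · exact Or.inl (realizable_of_not_not h')
      · exact Or.inr ⟨k, α, h₁, h₂⟩
  exact ⟨v, hmodel.isModel hp,
    fun α => preserves_of_atoms hS hu.1 hval (fun i => (pvar i).1)
      (fun β hβ => (pbox _ β hβ).1) α le_rfl,
    fun α => preserves_of_atoms hF hval hw.1 (fun i => (pvar i).2)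
      (fun β hβ => (pbox _ β hβ).2) α le_rfl⟩

theorem exists_isVal_of_atoms (g : ModalForm → Bool) : ∃ v, IsVal v ∧
    (∀ i, v (.var i) = g (.var i)) ∧ ∀ β, v (.box β) = g (.box β) :=
  ⟨fun φ => ModalForm.rec (motive := fun _ => Bool)
    (fun i => g (.var i)) false (fun _ _ a b => a && b) (fun _ _ a b => a || b)
    (fun _ _ a b => !a || b) (fun β _ => g (.box β)) φ,
    ⟨rfl, fun _ _ => rfl, fun _ _ => rfl, fun _ _ => rfl⟩, fun _ => rfl, fun _ => rfl⟩

/-- One application of the modal reduction principle. -/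
def Step (m n : ℕ) (a b : ModalForm) : Prop := ∃ α, a = boxIter n α ∧ b = boxIter m α

theorem IsModel.of_chain {v : ModalForm → Bool} (hv : IsModel m n v) {a b : ModalForm}
    (h : Relation.ReflTransGen (Step m n) a b) (ha : v a = true) : v b = true := by
  induction h with
  | refl => exact ha
  | tail _ hs ih =>
    obtain ⟨α, rfl, rfl⟩ := hs
    exact hv.boxIter_true ih

theorem chain_iff {p : ModalForm → Prop} (hp : ∀ α, p (.box α) ↔ p α) {a b : ModalForm}
    (h : Relation.ReflTransGen (Step m n) a b) : p a ↔ p b := by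
  have hi : ∀ k α, p (boxIter k α) ↔ p α := by
    intro k α
    induction k with
    | zero => rfl
    | succ k ih => exact (hp _).trans ih
  induction h with
  | refl => rfl
  | tail _ hs ih =>
    obtain ⟨α, rfl, rfl⟩ := hs
    exact ih.trans ((hi n α).trans (hi m α).symm)

theorem amalgamates_of_zero_iff (hmn : m = 0 ↔ n = 0)
    (hS : SignClosed S) (hF : SignClosed F) (hFbox : ∀ b α, F b (.box α) ↔ F b α)
    (hu : IsModel m n u) (hw : IsModel m n w)
    (hagree : ∀ b α, S b α → F b α → u α = b → w α = b) : Amalgamates m n S F u w := by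
  classical
  let low : ModalForm → Prop := fun a =>
    (S true a ∧ u a = true) ∨ (F false a ∧ w a = true) ∨ ∀ v, IsModel m n v → v a = true
  let up : ModalForm → Prop := fun b => ∃ a, low a ∧ Relation.ReflTransGen (Step m n) a b
  obtain ⟨v, hval, hvar, hbox⟩ := exists_isVal_of_atoms fun a => decide (up a)
  have patom : ∀ a, v a = decide (up a) → Preserves S u v a ∧ Preserves F v w a := by
    intro a ha
    constructor
    · rintro (_ | _) hSa hua
      · rw [ha, decide_eq_false]
        rintro ⟨a₀, hl, hc⟩
        have hu' : u a₀ ≠ true := fun h => by simpa [hua] using hu.of_chain hc h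
        rcases hl with ⟨-, h⟩ | ⟨h₁, h₂⟩ | h
        · exact hu' h
        · have := hagree false a hSa ((chain_iff (hFbox false) hc).1 h₁) hua
          simpa [this] using hw.of_chain hc h₂
        · exact hu' (h u hu)
      · rw [ha, decide_eq_true]
        exact ⟨a, Or.inl ⟨hSa, hua⟩, .refl⟩
    · rintro (_ | _) hFa hva
      · by_contra hc
        rw [Bool.not_eq_false] at hc
        rw [ha, decide_eq_false_iff_not] at hva
        exact hva ⟨a, Or.inr (Or.inl ⟨hFa, hc⟩), .refl⟩
      · rw [ha, decide_eq_true_iff] at hva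
        obtain ⟨a₀, hl, hc⟩ := hva
        refine hw.of_chain hc ?_
        rcases hl with ⟨h₁, h₂⟩ | ⟨-, h⟩ | h
        · exact hagree true a₀ h₁ ((chain_iff (hFbox true) hc).2 hFa) h₂
        · exact h
        · exact h w hw
  have hmodel : IsModel m n v := by
    refine isModel_of_realizable hval ?_ fun β => ?_
    · intro α h
      rcases Nat.eq_zero_or_pos m with h0 | h0
      · rw [hmn.1 h0] at h
        rwa [h0]
      · have hn : n ≠ 0 := fun h => h0.ne' (hmn.2 h)
        have hup : ∀ j, j ≠ 0 → v (boxIter j α) = decide (up (boxIter j α)) := by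
          rintro (_ | j) hj
          · exact absurd rfl hj
          · exact hbox _
        rw [hup _ hn, decide_eq_true_iff] at h
        rw [hup _ h0.ne', decide_eq_true_iff]
        obtain ⟨a₀, hl, hc⟩ := h
        exact ⟨a₀, hl, hc.tail ⟨α, rfl, rfl⟩⟩
    · by_cases h : up (.box β)
      · rw [hbox, decide_eq_true h]
        obtain ⟨a₀, hl, hc⟩ := h
        have : ∀ v', IsModel m n v' → v' a₀ = true → Realizable m n true β :=
          fun v' hv' h => hv'.of_chain hc h ▸ hv'.realizable_box β
        rcases hl with ⟨-, h⟩ | ⟨-, h⟩ | h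
        exacts [this u hu h, this w hw h, this u hu (h u hu)]
      · rw [hbox, decide_eq_false h]
        by_contra hc
        refine h ⟨_, Or.inr (Or.inr fun v' hv' => ?_), .refl⟩
        by_contra h'
        rw [Bool.not_eq_true] at h'
        exact hc (h' ▸ hv'.realizable_box β)
  exact ⟨v, hmodel,
    fun α => preserves_of_atoms hS hu.1 hval (fun i => (patom _ (hvar i)).1)
      (fun β _ => (patom _ (hbox β)).1) α le_rfl,
    fun α => preserves_of_atoms hF hval hw.1 (fun i => (patom _ (hvar i)).2)
      (fun β _ => (patom _ (hbox β)).2) α le_rfl⟩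

theorem amalgamates (hS : SignClosed S) (hF : SignClosed F)
    (hFbox : ∀ b α, F b (.box α) ↔ F b α) (hu : IsModel m n u) (hw : IsModel m n w)
    (hagree : ∀ b α, S b α → F b α → u α = b → w α = b) : Amalgamates m n S F u w := by
  rcases m with _ | m <;> rcases n with _ | n
  · exact amalgamates_of_zero_iff Iff.rfl hS hF hFbox hu hw hagree
  · exact amalgamates_of_propagates (propagates_false n) hS hF hu hw hagree
  · exact amalgamates_of_propagates (propagates_true m) hS hF hu hw hagree
  · exact amalgamates_of_zero_iff (by simp) hS hF hFbox hu hw hagree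

end Amalgamation

/-- A finite list of formulas defines the upward closure of any class of valuations. -/
theorem exists_form_upward_closure (Q : ModalForm → Prop) (hfls : Q .fls)
    (hand : ∀ α β, Q α → Q β → Q (.and α β)) (hor : ∀ α β, Q α → Q β → Q (.or α β))
    (himp : Q (.imp .fls .fls)) (E : List ModalForm) (hE : ∀ a ∈ E, Q a)
    (U : (ModalForm → Bool) → Prop) :
    ∃ χ, Q χ ∧ ∀ w, IsVal w →
      (w χ = true ↔ ∃ u, U u ∧ ∀ a ∈ E, u a = true → w a = true) := by
  induction E generalizing U with
  | nil =>
    by_cases h : ∃ u, U u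
    · exact ⟨_, himp, fun w hw => by simp [hw.imp, hw.fls, h]⟩
    · exact ⟨_, hfls, fun w hw => by simpa [hw.fls] using h⟩
  | cons a E ih =>
    have hE' : ∀ a ∈ E, Q a := fun b hb => hE b (List.mem_cons_of_mem _ hb)
    obtain ⟨χ₁, hQ₁, h₁⟩ := ih hE' fun u => U u ∧ u a = false
    obtain ⟨χ₂, hQ₂, h₂⟩ := ih hE' fun u => U u ∧ u a = true
    refine ⟨_, hor _ _ hQ₁ (hand _ _ (hE a List.mem_cons_self) hQ₂), fun w hw => ?_⟩
    rw [hw.or, hw.and, Bool.or_eq_true, Bool.and_eq_true, h₁ w hw, h₂ w hw]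
    constructor
    · rintro (⟨u, ⟨hU, hua⟩, h⟩ | ⟨hwa, u, ⟨hU, hua⟩, h⟩)
      · exact ⟨u, hU, by simpa [hua] using h⟩
      · exact ⟨u, hU, by simpa [hua, hwa] using h⟩
    · rintro ⟨u, hU, h⟩
      rw [List.forall_mem_cons] at h
      cases hua : u a with
      | false => exact Or.inl ⟨u, ⟨hU, hua⟩, h.2⟩
      | true => exact Or.inr ⟨h.1 hua, u, ⟨hU, hua⟩, h.2⟩

end ModalForm

open ModalForm in
/-- NRA enjoys the uniform Lyndon interpolation property. -/
theorem NRA_ULIP (m n : ℕ) (φ : ModalForm) (Pp Pm : Finset ℕ) :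
    ∃ χ : ModalForm,
      χ.Vpos ⊆ φ.Vpos \ Pp ∧ χ.Vneg ⊆ φ.Vneg \ Pm ∧
      NRA m n (.imp φ χ) ∧
      ∀ ψ : ModalForm, NRA m n (.imp φ ψ) →
        ψ.Vpos ∩ Pp = ∅ → ψ.Vneg ∩ Pm = ∅ → NRA m n (.imp χ ψ) := by
  classical
  let S : Bool → ModalForm → Prop := fun b α =>
    α ∈ φ.subs_s2 ∧ ∀ c, α.Vsgn c ⊆ φ.Vsgn (c == b)
  let P : Bool → Finset ℕ := fun c => if c then Pp else Pm
  let F : Bool → ModalForm → Prop := fun b α => ∀ c, Disjoint (α.Vsgn c) (P (c == b))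
  have hnot : ∀ b c : Bool, (c == !b) = ((!c) == b) := by decide
  have hS : SignClosed S := by
    have mem : ∀ {α β}, β ∈ φ.subs_s2 → α ∈ β.subs_s2 → α ∈ φ.subs_s2 :=
      fun hβ hα => subs_subset_of_mem hβ hα
    refine ⟨?_, ?_, ?_, ?_⟩
    · rintro b α β ⟨h, hV⟩
      simp only [Vsgn, Finset.union_subset_iff] at hV
      exact ⟨⟨mem h (by simp [subs_s2, self_mem_subs_s2]), fun c => (hV c).1⟩,
        ⟨mem h (by simp [subs_s2, self_mem_subs_s2]), fun c => (hV c).2⟩⟩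
    · rintro b α β ⟨h, hV⟩
      simp only [Vsgn, Finset.union_subset_iff] at hV
      exact ⟨⟨mem h (by simp [subs_s2, self_mem_subs_s2]), fun c => (hV c).1⟩,
        ⟨mem h (by simp [subs_s2, self_mem_subs_s2]), fun c => (hV c).2⟩⟩
    · rintro b α β ⟨h, hV⟩
      simp only [Vsgn, Finset.union_subset_iff] at hV
      refine ⟨⟨mem h (by simp [subs_s2, self_mem_subs_s2]), fun c => ?_⟩,
        ⟨mem h (by simp [subs_s2, self_mem_subs_s2]), fun c => (hV c).2⟩⟩
      rw [hnot]
      simpa using (hV (!c)).1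
    · rintro b α ⟨h, hV⟩
      exact ⟨mem h (by simp [subs_s2, self_mem_subs_s2]), hV⟩
  have hF : SignClosed F := by
    refine ⟨?_, ?_, ?_, fun _ _ h => h⟩
    · intro b α β h
      simp only [F, Vsgn, Finset.disjoint_union_left] at h
      exact ⟨fun c => (h c).1, fun c => (h c).2⟩
    · intro b α β h
      simp only [F, Vsgn, Finset.disjoint_union_left] at h
      exact ⟨fun c => (h c).1, fun c => (h c).2⟩
    · intro b α β h
      simp only [F, Vsgn, Finset.disjoint_union_left] at h
      refine ⟨fun c => ?_, fun c => (h c).2⟩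
      rw [hnot]
      simpa using (h (!c)).1
  let Q : ModalForm → Prop := fun α => ∀ c, α.Vsgn c ⊆ φ.Vsgn c \ P c
  have hQ : ∀ {b : Bool} {α : ModalForm}, S b α → F b α →
      ∀ c, α.Vsgn c ⊆ φ.Vsgn (c == b) \ P (c == b) :=
    fun hSα hFα c => Finset.subset_sdiff.2 ⟨hSα.2 c, hFα c⟩
  let E : List ModalForm := φ.subs_s2.filter (fun a => S true a ∧ F true a) ++
    (φ.subs_s2.filter (fun a => S false a ∧ F false a)).map ModalForm.neg
  obtain ⟨χ, hχ, hiff⟩ := exists_form_upward_closure Q (by simp [Q, Vsgn])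
    (fun α β h₁ h₂ c => Finset.union_subset (h₁ c) (h₂ c))
    (fun α β h₁ h₂ c => Finset.union_subset (h₁ c) (h₂ c)) (by simp [Q, Vsgn]) E (by
      intro a ha c
      simp only [E, List.mem_append, List.mem_map, List.mem_filter, decide_eq_true_eq] at ha
      rcases ha with ⟨-, h₁, h₂⟩ | ⟨a, ⟨-, h₁, h₂⟩, rfl⟩
      · simpa using hQ h₁ h₂ c
      · simpa [ModalForm.neg, Vsgn] using hQ h₁ h₂ (!c))
    (fun u => IsModel m n u ∧ u φ = true)
  refine ⟨χ, hχ true, hχ false, NRA_of_forall_isModel fun w hw => ?_, fun ψ hψ hPp hPm =>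
    NRA_of_forall_isModel fun w hw => ?_⟩
  · rw [hw.1.imp]
    cases h : w φ with
    | false => rfl
    | true => simpa using (hiff w hw.1).2 ⟨w, ⟨hw, h⟩, fun _ _ h => h⟩
  · rw [hw.1.imp]
    cases h : w χ with
    | false => rfl
    | true =>
      obtain ⟨u, ⟨hu, huφ⟩, hE⟩ := (hiff w hw.1).1 h
      obtain ⟨v, hv, hvS, hvF⟩ := amalgamates hS hF (fun _ _ => Iff.rfl) hu hw (by
        rintro (_ | _) α h₁ h₂ h₃
        · have := hE α.neg (by
            simp only [E, List.mem_append, List.mem_map, List.mem_filter, decide_eq_true_eq]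
            exact Or.inr ⟨α, ⟨h₁.1, h₁, h₂⟩, rfl⟩)
          simpa [hu.1.neg, hw.1.neg, h₃] using this
        · exact hE α (by
            simp only [E, List.mem_append, List.mem_filter, decide_eq_true_eq]
            exact Or.inl ⟨h₁.1, h₁, h₂⟩) h₃)
      have hvφ := hvS φ true ⟨self_mem_subs_s2 φ, by simp⟩ huφ
      have hvψ := hv.2 _ hψ
      rw [hv.1.imp, hvφ] at hvψ
      have hFψ : F true ψ := by
        rintro (_ | _)
        · exact Finset.disjoint_iff_inter_eq_empty.2 hPm
        · exact Finset.disjoint_iff_inter_eq_empty.2 hPp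
      simpa using hvF ψ true hFψ (by simpa using hvψ)
end

section
/- For all natural numbers m and n, the logic NAmn enjoys the Lyndon interpolation property (LIP): whenever NAmn ⊢ φ → ψ, there exists a modal formula χ such that V^•(χ) ⊆ V^•(φ) ∩ V^•(ψ) for each • ∈ {+,−}, NAmn ⊢ φ → χ, and NAmn ⊢ χ → ψ. -/
/-- Derivability from a set of premises, where necessitation applies to theorems only. -/
inductive Entails (m n : ℕ) (S : Set ModalForm) : ModalForm → Prop
  | mem {φ : ModalForm} : φ ∈ S → Entails m n S φ
  | thm {φ : ModalForm} : NA m n φ → Entails m n S φ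
  | mp {φ ψ : ModalForm} : Entails m n S (.imp φ ψ) → Entails m n S φ → Entails m n S ψ

namespace Entails

variable {m n : ℕ} {S : Set ModalForm}

theorem taut (p : PropForm) (σ : ℕ → ModalForm) (h : p.Taut) : Entails m n S (p.subst σ) :=
  thm (NA.taut p σ h)

theorem imp_refl (a : ModalForm) : Entails m n S (.imp a a) :=
  taut (.imp (.var 0) (.var 0)) (fun i => [a].getD i .fls)
    (by intro v; simp [PropForm.eval])

theorem imp_const (a b : ModalForm) : Entails m n S (.imp b (.imp a b)) :=
  taut (.imp (.var 1) (.imp (.var 0) (.var 1))) (fun i => [a, b].getD i .fls)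
    (by intro v; simp only [PropForm.eval]; grind)

theorem imp_distrib (a b c : ModalForm) :
    Entails m n S (.imp (.imp a (.imp b c)) (.imp (.imp a b) (.imp a c))) :=
  taut (.imp (.imp (.var 0) (.imp (.var 1) (.var 2)))
      (.imp (.imp (.var 0) (.var 1)) (.imp (.var 0) (.var 2)))) (fun i => [a, b, c].getD i .fls)
    (by intro v; simp only [PropForm.eval]; grind)

theorem or_map (x y c d : ModalForm) :
    Entails m n S (.imp (.or x y) (.imp (.imp x c) (.imp (.imp y d) (.or c d)))) :=
  taut (.imp (.or (.var 0) (.var 1)) (.imp (.imp (.var 0) (.var 2))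
      (.imp (.imp (.var 1) (.var 3)) (.or (.var 2) (.var 3))))) (fun i => [x, y, c, d].getD i .fls)
    (by intro v; simp only [PropForm.eval]; grind)

theorem neg_or_intro (c d : ModalForm) :
    Entails m n S (.imp c.neg (.imp d.neg (ModalForm.or c d).neg)) :=
  taut (.imp (.imp (.var 0) .fls) (.imp (.imp (.var 1) .fls) (.imp (.or (.var 0) (.var 1)) .fls)))
    (fun i => [c, d].getD i .fls)
    (by intro v; simp only [PropForm.eval]; grind)

theorem neg_neg_intro (a : ModalForm) : Entails m n S (.imp a a.neg.neg) :=
  taut (.imp (.var 0) (.imp (.imp (.var 0) .fls) .fls)) (fun i => [a].getD i .fls)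
    (by intro v; simp only [PropForm.eval]; grind)

theorem or_of_imp (a b : ModalForm) : Entails m n S (.imp (.imp a b) (.or a.neg b)) :=
  taut (.imp (.imp (.var 0) (.var 1)) (.or (.imp (.var 0) .fls) (.var 1)))
    (fun i => [a, b].getD i .fls)
    (by intro v; simp only [PropForm.eval]; grind)

theorem left_of_neg_imp (a b : ModalForm) :
    Entails m n S (.imp (ModalForm.imp a b).neg a) :=
  taut (.imp (.imp (.imp (.var 0) (.var 1)) .fls) (.var 0)) (fun i => [a, b].getD i .fls)
    (by intro v; simp only [PropForm.eval]; grind)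

theorem neg_right_of_neg_imp (a b : ModalForm) :
    Entails m n S (.imp (ModalForm.imp a b).neg b.neg) :=
  taut (.imp (.imp (.imp (.var 0) (.var 1)) .fls) (.imp (.var 1) .fls))
    (fun i => [a, b].getD i .fls)
    (by intro v; simp only [PropForm.eval]; grind)

theorem and_left (a b : ModalForm) : Entails m n S (.imp (.and a b) a) :=
  taut (.imp (.and (.var 0) (.var 1)) (.var 0)) (fun i => [a, b].getD i .fls)
    (by intro v; simp only [PropForm.eval]; grind)

theorem and_right (a b : ModalForm) : Entails m n S (.imp (.and a b) b) :=
  taut (.imp (.and (.var 0) (.var 1)) (.var 1)) (fun i => [a, b].getD i .fls)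
    (by intro v; simp only [PropForm.eval]; grind)

theorem or_of_neg_and (a b : ModalForm) :
    Entails m n S (.imp (ModalForm.and a b).neg (.or a.neg b.neg)) :=
  taut (.imp (.imp (.and (.var 0) (.var 1)) .fls) (.or (.imp (.var 0) .fls) (.imp (.var 1) .fls)))
    (fun i => [a, b].getD i .fls)
    (by intro v; simp only [PropForm.eval]; grind)

theorem neg_left_of_neg_or (a b : ModalForm) :
    Entails m n S (.imp (ModalForm.or a b).neg a.neg) :=
  taut (.imp (.imp (.or (.var 0) (.var 1)) .fls) (.imp (.var 0) .fls))
    (fun i => [a, b].getD i .fls)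
    (by intro v; simp only [PropForm.eval]; grind)

theorem neg_right_of_neg_or (a b : ModalForm) :
    Entails m n S (.imp (ModalForm.or a b).neg b.neg) :=
  taut (.imp (.imp (.or (.var 0) (.var 1)) .fls) (.imp (.var 1) .fls))
    (fun i => [a, b].getD i .fls)
    (by intro v; simp only [PropForm.eval]; grind)

theorem or_self_intro (a : ModalForm) : Entails m n S (.imp a (.or a a)) :=
  taut (.imp (.var 0) (.or (.var 0) (.var 0))) (fun i => [a].getD i .fls)
    (by intro v; simp only [PropForm.eval]; grind)

theorem contrapose (a b : ModalForm) : Entails m n S (.imp (.imp a b) (.imp b.neg a.neg)) :=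
  taut (.imp (.imp (.var 0) (.var 1)) (.imp (.imp (.var 1) .fls) (.imp (.var 0) .fls)))
    (fun i => [a, b].getD i .fls)
    (by intro v; simp only [PropForm.eval]; grind)

theorem of_contrapose (a b : ModalForm) : Entails m n S (.imp (.imp b.neg a.neg) (.imp a b)) :=
  taut (.imp (.imp (.imp (.var 1) .fls) (.imp (.var 0) .fls)) (.imp (.var 0) (.var 1)))
    (fun i => [a, b].getD i .fls)
    (by intro v; simp only [PropForm.eval]; grind)

theorem mono {T : Set ModalForm} (hST : S ⊆ T) {φ : ModalForm} (h : Entails m n S φ) :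
    Entails m n T φ := by
  induction h with
  | mem h => exact mem (hST h)
  | thm h => exact thm h
  | mp _ _ ih₁ ih₂ => exact mp ih₁ ih₂

theorem deduction {a φ : ModalForm} (h : Entails m n (insert a S) φ) :
    Entails m n S (.imp a φ) := by
  induction h with
  | mem h =>
    rcases h with rfl | h
    · exact imp_refl _
    · exact mp (imp_const _ _) (mem h)
  | thm h => exact mp (imp_const _ _) (thm h)
  | mp _ _ ih₁ ih₂ => exact mp (mp (imp_distrib _ _ _) ih₁) ih₂

theorem toNA {φ : ModalForm} (h : Entails m n ∅ φ) : NA m n φ := by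
  induction h with
  | mem h => exact h.elim
  | thm h => exact h
  | mp _ _ ih₁ ih₂ => exact NA.mp _ _ ih₁ ih₂

end Entails

/-- The formulas on one of the two sides of a family of formulas tagged with a side. -/
def side (S : Set (Bool × ModalForm)) (s : Bool) : Set ModalForm := {a | (s, a) ∈ S}

theorem side_mono {S T : Set (Bool × ModalForm)} (h : S ⊆ T) (s : Bool) : side S s ⊆ side T s :=
  fun _ ha => h ha

theorem Entails.exists_of_chain {m n : ℕ} {c : Set (Set (Bool × ModalForm))}
    (hc : IsChain (· ⊆ ·) c) (hne : c.Nonempty) {s : Bool} {φ : ModalForm}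
    (h : Entails m n (side (⋃₀ c) s) φ) : ∃ t ∈ c, Entails m n (side t s) φ := by
  induction h with
  | mem h =>
    obtain ⟨t, ht, hφ⟩ := h
    exact ⟨t, ht, .mem hφ⟩
  | thm h =>
    obtain ⟨t, ht⟩ := hne
    exact ⟨t, ht, .thm h⟩
  | mp _ _ ih₁ ih₂ =>
    obtain ⟨t₁, ht₁, h₁⟩ := ih₁
    obtain ⟨t₂, ht₂, h₂⟩ := ih₂
    rcases hc.total ht₁ ht₂ with h | h
    · exact ⟨t₂, ht₂, .mp (h₁.mono (side_mono h s)) h₂⟩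
    · exact ⟨t₁, ht₁, .mp h₁ (h₂.mono (side_mono h s))⟩

/-- The signed variables of `χ` are among those allowed on side `s`. -/
def Fits (A : Bool → Bool → Finset ℕ) (s : Bool) (χ : ModalForm) : Prop :=
  ∀ b, χ.Vsgn b ⊆ A s b

section Fits

variable {A : Bool → Bool → Finset ℕ} {s : Bool} {a b : ModalForm}

theorem fits_fls : Fits A s .fls := by
  intro b; cases b <;> simp [ModalForm.Vsgn]

theorem fits_and : Fits A s (.and a b) ↔ Fits A s a ∧ Fits A s b := by
  simp only [Fits, ModalForm.Vsgn, Finset.union_subset_iff, forall_and]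

theorem fits_or : Fits A s (.or a b) ↔ Fits A s a ∧ Fits A s b := by
  simp only [Fits, ModalForm.Vsgn, Finset.union_subset_iff, forall_and]

theorem fits_neg : Fits A s a.neg ↔ ∀ c, a.Vsgn (!c) ⊆ A s c := by
  simp [Fits, ModalForm.neg, ModalForm.Vsgn]

theorem fits_neg_neg : Fits A s a.neg.neg ↔ Fits A s a := by
  simp [Fits, ModalForm.neg, ModalForm.Vsgn]

theorem fits_imp : Fits A s (.imp a b) ↔ Fits A s a.neg ∧ Fits A s b := by
  rw [fits_neg]
  simp only [Fits, ModalForm.Vsgn, Finset.union_subset_iff, forall_and]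

theorem fits_neg_imp : Fits A s (ModalForm.imp a b).neg ↔ Fits A s a ∧ Fits A s b.neg := by
  rw [fits_neg, fits_neg]
  simp only [Fits, ModalForm.Vsgn, Finset.union_subset_iff, forall_and, Bool.not_not]

theorem fits_neg_and : Fits A s (ModalForm.and a b).neg ↔ Fits A s a.neg ∧ Fits A s b.neg := by
  simp only [fits_neg, ModalForm.Vsgn, Finset.union_subset_iff, forall_and]

theorem fits_neg_or : Fits A s (ModalForm.or a b).neg ↔ Fits A s a.neg ∧ Fits A s b.neg := by
  simp only [fits_neg, ModalForm.Vsgn, Finset.union_subset_iff, forall_and]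

theorem ModalForm.Vsgn_boxIter (k : ℕ) (a : ModalForm) (c : Bool) :
    (ModalForm.boxIter k a).Vsgn c = a.Vsgn c := by
  induction k with
  | zero => rfl
  | succ k ih => simpa [ModalForm.boxIter, ModalForm.Vsgn] using ih

theorem fits_boxIter (k : ℕ) : Fits A s (ModalForm.boxIter k a) ↔ Fits A s a := by
  simp only [Fits, ModalForm.Vsgn_boxIter]

theorem fits_neg_boxIter (k : ℕ) : Fits A s (ModalForm.boxIter k a).neg ↔ Fits A s a.neg := by
  simp only [fits_neg, ModalForm.Vsgn_boxIter]

end Fits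

/-- Some formula in the allowed vocabulary follows from one side and is refuted by the other. -/
def Separable (m n : ℕ) (A : Bool → Bool → Finset ℕ) (S : Set (Bool × ModalForm)) : Prop :=
  ∃ χ : ModalForm, Fits A true χ ∧ Fits A false χ.neg ∧
    Entails m n (side S true) χ ∧ Entails m n (side S false) χ.neg

section Separable

variable {m n : ℕ} {A : Bool → Bool → Finset ℕ} {S : Set (Bool × ModalForm)}

theorem separable_iff (s : Bool) : Separable m n A S ↔
    ∃ χ : ModalForm, Fits A s χ ∧ Fits A (!s) χ.neg ∧
      Entails m n (side S s) χ ∧ Entails m n (side S (!s)) χ.neg := by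
  cases s
  · constructor
    · rintro ⟨χ, h₁, h₂, h₃, h₄⟩
      exact ⟨χ.neg, h₂, fits_neg_neg.2 h₁, h₄, .mp (.neg_neg_intro χ) h₃⟩
    · rintro ⟨χ, h₁, h₂, h₃, h₄⟩
      exact ⟨χ.neg, h₂, fits_neg_neg.2 h₁, h₄, .mp (.neg_neg_intro χ) h₃⟩
  · rfl

theorem separable_of_entails_fls {s : Bool} (h : Entails m n (side S s) .fls) :
    Separable m n A S :=
  (separable_iff s).2 ⟨.fls, fits_fls, fits_imp.2 ⟨fits_neg.2 fun c => by
    cases c <;> simp [ModalForm.Vsgn], fits_fls⟩, h, .imp_refl _⟩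

theorem side_insert_self (s : Bool) (x : ModalForm) :
    side (insert (s, x) S) s = insert x (side S s) := by
  ext a; simp [side]

theorem side_insert_not (s : Bool) (x : ModalForm) :
    side (insert (s, x) S) (!s) = side S (!s) := by
  ext a; simp [side]

theorem separable_of_or {s : Bool} {x y : ModalForm} (h : Entails m n (side S s) (.or x y))
    (hx : Separable m n A (insert (s, x) S)) (hy : Separable m n A (insert (s, y) S)) :
    Separable m n A S := by
  obtain ⟨c, c₁, c₂, c₃, c₄⟩ := (separable_iff s).1 hx
  obtain ⟨d, d₁, d₂, d₃, d₄⟩ := (separable_iff s).1 hy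
  rw [side_insert_self] at c₃ d₃
  rw [side_insert_not] at c₄ d₄
  exact (separable_iff s).2 ⟨.or c d, fits_or.2 ⟨c₁, d₁⟩, fits_neg_or.2 ⟨c₂, d₂⟩,
    .mp (.mp (.mp (.or_map x y c d) h) c₃.deduction) d₃.deduction,
    .mp (.mp (.neg_or_intro c d) c₄) d₄⟩

/-- Maximality among the families that fit the allowed vocabulary and are not separable. -/
def IsMaxInseparable (m n : ℕ) (A : Bool → Bool → Finset ℕ) (S : Set (Bool × ModalForm)) : Prop :=
  Maximal (fun S => (∀ s a, (s, a) ∈ S → Fits A s a) ∧ ¬ Separable m n A S) S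

theorem exists_isMaxInseparable {S₀ : Set (Bool × ModalForm)}
    (hfit : ∀ s a, (s, a) ∈ S₀ → Fits A s a) (hS₀ : ¬ Separable m n A S₀) :
    ∃ S, S₀ ⊆ S ∧ IsMaxInseparable m n A S := by
  refine zorn_subset_nonempty
    {S | (∀ s a, (s, a) ∈ S → Fits A s a) ∧ ¬ Separable m n A S} ?_ S₀ ⟨hfit, hS₀⟩
  intro c hcs hc hne
  refine ⟨⋃₀ c, ⟨?_, ?_⟩, fun t ht => Set.subset_sUnion_of_mem ht⟩
  · rintro s a ⟨t, ht, ha⟩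
    exact (hcs ht).1 s a ha
  · rintro ⟨χ, h₁, h₂, h₃, h₄⟩
    obtain ⟨t, ht, h₃⟩ := h₃.exists_of_chain hc hne
    obtain ⟨u, hu, h₄⟩ := h₄.exists_of_chain hc hne
    rcases hc.total ht hu with h | h
    · exact (hcs hu).2 ⟨χ, h₁, h₂, h₃.mono (side_mono h _), h₄⟩
    · exact (hcs ht).2 ⟨χ, h₁, h₂, h₃, h₄.mono (side_mono h _)⟩

end Separable

/-- A truth assignment to modal formulas that respects the propositional connectives. -/
structure IsValuation (v : ModalForm → Prop) : Prop where
  fls : ¬ v .fls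
  and : ∀ a b, v (.and a b) ↔ v a ∧ v b
  or : ∀ a b, v (.or a b) ↔ v a ∨ v b
  imp : ∀ a b, v (.imp a b) ↔ (v a → v b)

theorem IsValuation.neg {v : ModalForm → Prop} (hv : IsValuation v) (a : ModalForm) :
    v a.neg ↔ ¬ v a := by
  simp [ModalForm.neg, hv.imp, hv.fls]

open Classical in
theorem IsValuation.subst_iff {v : ModalForm → Prop} (hv : IsValuation v) (σ : ℕ → ModalForm)
    (p : PropForm) : v (p.subst σ) ↔ p.eval (fun i => decide (v (σ i))) = true := by
  induction p with
  | var i => simp [PropForm.subst, PropForm.eval]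
  | fls => simp [PropForm.subst, PropForm.eval, hv.fls]
  | and p q ihp ihq => simp [PropForm.subst, PropForm.eval, hv.and, ihp, ihq]
  | or p q ihp ihq => simp [PropForm.subst, PropForm.eval, hv.or, ihp, ihq]
  | imp p q ihp ihq =>
    simp only [PropForm.subst, PropForm.eval, hv.imp, ihp, ihq]
    grind

theorem IsValuation.taut {v : ModalForm → Prop} (hv : IsValuation v) {p : PropForm}
    (hp : p.Taut) (σ : ℕ → ModalForm) : v (p.subst σ) :=
  (hv.subst_iff σ p).2 (hp _)

namespace IsMaxInseparable

variable {m n : ℕ} {A : Bool → Bool → Finset ℕ} {S : Set (Bool × ModalForm)}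

theorem fits (hS : IsMaxInseparable m n A S) {s : Bool} {a : ModalForm} (ha : a ∈ side S s) :
    Fits A s a :=
  hS.prop.1 s a ha

theorem separable_insert (hS : IsMaxInseparable m n A S) {s : Bool} {a : ModalForm}
    (hf : Fits A s a) (ha : a ∉ side S s) : Separable m n A (insert (s, a) S) := by
  by_contra hsep
  refine ha (hS.le_of_ge ⟨?_, hsep⟩ (Set.subset_insert _ _) (Set.mem_insert _ _))
  rintro t b (hb | hb)
  · cases hb
    exact hf
  · exact hS.prop.1 t b hb

theorem mem_or_mem (hS : IsMaxInseparable m n A S) {s : Bool} {a b : ModalForm}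
    (h : Entails m n (side S s) (.or a b)) (ha : Fits A s a) (hb : Fits A s b) :
    a ∈ side S s ∨ b ∈ side S s := by
  by_contra! hab
  exact hS.prop.2 (separable_of_or h (hS.separable_insert ha hab.1) (hS.separable_insert hb hab.2))

theorem mem_of_entails (hS : IsMaxInseparable m n A S) {s : Bool} {a : ModalForm}
    (h : Entails m n (side S s) a) (ha : Fits A s a) : a ∈ side S s :=
  (hS.mem_or_mem (.mp (.or_self_intro a) h) ha ha).elim id id

theorem neg_notMem (hS : IsMaxInseparable m n A S) {s t : Bool} {a : ModalForm}
    (ha : a ∈ side S s) : a.neg ∉ side S t := by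
  intro hna
  by_cases hst : t = s
  · subst hst
    exact hS.prop.2 (separable_of_entails_fls (.mp (.mem hna) (.mem ha)))
  · obtain rfl : t = !s := by cases s <;> cases t <;> simp_all
    exact hS.prop.2 ((separable_iff s).2 ⟨a, hS.fits ha, hS.fits hna, .mem ha, .mem hna⟩)

theorem not_NA (hS : IsMaxInseparable m n A S) {s : Bool} {a : ModalForm}
    (ha : a.neg ∈ side S s) : ¬ NA m n a :=
  fun h => hS.prop.2 (separable_of_entails_fls (.mp (.mem ha) (.thm h)))

theorem boxIter_mem (hS : IsMaxInseparable m n A S) {s : Bool} {a : ModalForm}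
    (ha : a.boxIter n ∈ side S s) : a.boxIter m ∈ side S s :=
  hS.mem_of_entails (.mp (.thm (.amn a)) (.mem ha))
    ((fits_boxIter m).2 ((fits_boxIter n).1 (hS.fits ha)))

theorem neg_boxIter_mem (hS : IsMaxInseparable m n A S) {s : Bool} {a : ModalForm}
    (ha : (a.boxIter m).neg ∈ side S s) : (a.boxIter n).neg ∈ side S s :=
  hS.mem_of_entails (.mp (.mp (.contrapose _ _) (.thm (.amn a))) (.mem ha))
    ((fits_neg_boxIter n).2 ((fits_neg_boxIter m).1 (hS.fits ha)))

/-- Truth lemma. -/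
theorem truth (hS : IsMaxInseparable m n A S) {v : ModalForm → Prop} (hv : IsValuation v)
    (hvar : ∀ i, v (.var i) ↔ ∃ s, .var i ∈ side S s)
    (hbox : ∀ a s, .box a ∈ side S s → v (.box a))
    (hnbox : ∀ a s, (ModalForm.box a).neg ∈ side S s → ¬ v (.box a)) (a : ModalForm) :
    (∀ s, a ∈ side S s → v a) ∧ (∀ s, a.neg ∈ side S s → ¬ v a) := by
  induction a with
  | var i =>
    refine ⟨fun s h => (hvar i).2 ⟨s, h⟩, fun s h hi => ?_⟩
    obtain ⟨t, ht⟩ := (hvar i).1 hi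
    exact hS.neg_notMem ht h
  | fls =>
    exact ⟨fun s h => (hS.prop.2 (separable_of_entails_fls (.mem h))).elim, fun _ _ => hv.fls⟩
  | and a b iha ihb =>
    rw [hv.and]
    constructor
    · intro s h
      have hf := fits_and.1 (hS.fits h)
      exact ⟨iha.1 s (hS.mem_of_entails (.mp (.and_left a b) (.mem h)) hf.1),
        ihb.1 s (hS.mem_of_entails (.mp (.and_right a b) (.mem h)) hf.2)⟩
    · rintro s h ⟨hva, hvb⟩
      have hf := fits_neg_and.1 (hS.fits h)
      rcases hS.mem_or_mem (.mp (.or_of_neg_and a b) (.mem h)) hf.1 hf.2 with h | h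
      · exact iha.2 s h hva
      · exact ihb.2 s h hvb
  | or a b iha ihb =>
    rw [hv.or]
    constructor
    · intro s h
      have hf := fits_or.1 (hS.fits h)
      exact (hS.mem_or_mem (.mem h) hf.1 hf.2).imp (iha.1 s) (ihb.1 s)
    · intro s h
      have hf := fits_neg_or.1 (hS.fits h)
      rintro (hva | hvb)
      · exact iha.2 s (hS.mem_of_entails (.mp (.neg_left_of_neg_or a b) (.mem h)) hf.1) hva
      · exact ihb.2 s (hS.mem_of_entails (.mp (.neg_right_of_neg_or a b) (.mem h)) hf.2) hvb
  | imp a b iha ihb =>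
    rw [hv.imp]
    constructor
    · intro s h hva
      have hf := fits_imp.1 (hS.fits h)
      rcases hS.mem_or_mem (.mp (.or_of_imp a b) (.mem h)) hf.1 hf.2 with h | h
      · exact (iha.2 s h hva).elim
      · exact ihb.1 s h
    · intro s h hab
      have hf := fits_neg_imp.1 (hS.fits h)
      exact ihb.2 s (hS.mem_of_entails (.mp (.neg_right_of_neg_imp a b) (.mem h)) hf.2)
        (hab (iha.1 s (hS.mem_of_entails (.mp (.left_of_neg_imp a b) (.mem h)) hf.1)))
  | box a _ => exact ⟨hbox a, hnbox a⟩

end IsMaxInseparable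

/-- The valuation with prescribed truth values for variables and boxed formulas. -/
def valuation (atm : ℕ → Prop) (bx : ModalForm → Prop) : ModalForm → Prop
  | .var i => atm i
  | .fls => False
  | .and a b => valuation atm bx a ∧ valuation atm bx b
  | .or a b => valuation atm bx a ∨ valuation atm bx b
  | .imp a b => valuation atm bx a → valuation atm bx b
  | .box a => bx a

theorem isValuation_valuation (atm : ℕ → Prop) (bx : ModalForm → Prop) :
    IsValuation (valuation atm bx) where
  fls := id
  and _ _ := Iff.rfl
  or _ _ := Iff.rfl
  imp _ _ := Iff.rfl

theorem IsValuation.of_NA {m n : ℕ} {v : ModalForm → Prop} (hv : IsValuation v)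
    (hnec : ∀ a, NA m n a → v (.box a)) (hamn : ∀ a, v (.boxIter n a) → v (.boxIter m a))
    {φ : ModalForm} (h : NA m n φ) : v φ := by
  induction h with
  | taut p σ hp => exact hv.taut hp σ
  | amn φ => exact (hv.imp _ _).2 (hamn φ)
  | mp φ ψ _ _ ih₁ ih₂ => exact (hv.imp _ _).1 ih₁ ih₂
  | nec φ h _ => exact hnec φ h

/-- An Aczel slash: truth at `L`, where `□a` holds if it belongs to `L`, or else if `a` is a theorem
true at every member of `H`. -/
def slash (m n : ℕ) (H : Set (Set ModalForm)) : ModalForm → Set ModalForm → Prop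
  | .var i, L => .var i ∈ L
  | .fls, _ => False
  | .and a b, L => slash m n H a L ∧ slash m n H b L
  | .or a b, L => slash m n H a L ∨ slash m n H b L
  | .imp a b, L => slash m n H a L → slash m n H b L
  | .box a, L => .box a ∈ L ∨ (NA m n a ∧ ∀ L' ∈ H, slash m n H a L')

section Slash

variable {m n : ℕ} {H : Set (Set ModalForm)}

theorem isValuation_slash (L : Set ModalForm) : IsValuation (fun a => slash m n H a L) where
  fls := id
  and _ _ := Iff.rfl
  or _ _ := Iff.rfl
  imp _ _ := Iff.rfl

theorem slash_of_boxIter (hH : ∅ ∈ H) {k : ℕ} {a : ModalForm}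
    (h : NA m n (a.boxIter k) ∧ ∀ L ∈ H, slash m n H (a.boxIter k) L) :
    NA m n a ∧ ∀ L ∈ H, slash m n H a L := by
  induction k with
  | zero => exact h
  | succ k ih => exact ih ((h.2 ∅ hH).resolve_left (Set.notMem_empty _))

theorem slash_boxIter {k : ℕ} {a : ModalForm} (h : NA m n a ∧ ∀ L ∈ H, slash m n H a L) :
    NA m n (a.boxIter k) ∧ ∀ L ∈ H, slash m n H (a.boxIter k) L := by
  induction k with
  | zero => exact h
  | succ k ih => exact ⟨.nec _ ih.1, fun _ _ => Or.inr ih⟩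

theorem slash_of_NA (hmn : m < n) (hH : ∅ ∈ H)
    (hacc : ∀ L ∈ H, ∀ a : ModalForm, a.boxIter n ∈ L → slash m n H (a.boxIter m) L)
    {φ : ModalForm} (h : NA m n φ) : ∀ L ∈ H, slash m n H φ L := by
  induction h with
  | taut p σ hp => exact fun L _ => (isValuation_slash L).taut hp σ
  | amn φ =>
    intro L hL hφ
    obtain ⟨k, rfl⟩ : ∃ k, n = k + 1 := ⟨n - 1, by omega⟩
    rcases hφ with hφ | hφ
    · exact hacc L hL φ hφ
    · exact (slash_boxIter (slash_of_boxIter hH hφ)).2 L hL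
  | mp φ ψ _ _ ih₁ ih₂ => exact fun L hL => ih₁ L hL (ih₂ L hL)
  | nec φ h ih => exact fun _ _ => Or.inr ⟨h, ih⟩

end Slash

theorem IsMaxInseparable.exists_valuation {m n : ℕ} {A : Bool → Bool → Finset ℕ}
    {S : Set (Bool × ModalForm)} (hS : IsMaxInseparable m n A S) :
    ∃ v : ModalForm → Prop, IsValuation v ∧ (∀ a, NA m n a → v a) ∧
      ∀ a, (∀ s, a ∈ side S s → v a) ∧ (∀ s, a.neg ∈ side S s → ¬ v a) := by
  rcases le_or_gt n m with hnm | hmn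
  · set v := valuation (fun i => ∃ s, .var i ∈ side S s)
      (fun a => ∀ s, (ModalForm.box a).neg ∉ side S s)
    have hv : IsValuation v := isValuation_valuation _ _
    have htruth := hS.truth hv (fun _ => Iff.rfl) (fun a s h t => hS.neg_notMem h)
      (fun a s h hv => hv s h)
    refine ⟨v, hv, fun a => hv.of_NA (fun b hb s hs => hS.not_NA hs (.nec b hb)) ?_, htruth⟩
    intro b hb
    cases m with
    | zero =>
      obtain rfl : n = 0 := by omega
      exact hb
    | succ k => exact fun s hs => (htruth _).2 s (hS.neg_boxIter_mem hs) hb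
  · set L : Set ModalForm := {a | ∃ s, a ∈ side S s}
    set H : Set (Set ModalForm) := {∅, L}
    have hv : IsValuation (fun a => slash m n H a L) := isValuation_slash L
    have htruth := hS.truth hv (fun _ => Iff.rfl) (fun a s h => Or.inl ⟨s, h⟩) (by
      rintro a s h (⟨t, ht⟩ | ⟨ha, -⟩)
      · exact hS.neg_notMem ht h
      · exact hS.not_NA h (.nec a ha))
    refine ⟨_, hv, fun a ha => slash_of_NA hmn (.inl rfl) ?_ ha L (.inr rfl), htruth⟩
    rintro _ (rfl | rfl) b hb
    · exact hb.elim
    · obtain ⟨s, hs⟩ := hb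
      exact (htruth _).1 s (hS.boxIter_mem hs)

/-- NA enjoys the Lyndon interpolation property. -/
theorem NA_LIP (m n : ℕ) (φ ψ : ModalForm) (h : NA m n (.imp φ ψ)) :
    ∃ χ : ModalForm,
      χ.Vpos ⊆ φ.Vpos ∩ ψ.Vpos ∧ χ.Vneg ⊆ φ.Vneg ∩ ψ.Vneg ∧
      NA m n (.imp φ χ) ∧ NA m n (.imp χ ψ) := by
  let A : Bool → Bool → Finset ℕ := fun s b => if s then φ.Vsgn b else ψ.neg.Vsgn b
  let S₀ : Set (Bool × ModalForm) := {(true, φ), (false, ψ.neg)}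
  by_cases hsep : Separable m n A S₀
  · obtain ⟨χ, h₁, h₂, h₃, h₄⟩ := hsep
    have hl : side S₀ true = insert φ ∅ := by ext a; simp [side, S₀]
    have hr : side S₀ false = insert ψ.neg ∅ := by ext a; simp [side, S₀]
    rw [hl] at h₃
    rw [hr] at h₄
    have hφ (b : Bool) : χ.Vsgn b ⊆ φ.Vsgn b := h₁ b
    have hψ (b : Bool) : χ.Vsgn b ⊆ ψ.Vsgn b := by
      simpa [A, ModalForm.neg, ModalForm.Vsgn] using h₂ (!b)
    exact ⟨χ, Finset.subset_inter (hφ _) (hψ _), Finset.subset_inter (hφ _) (hψ _),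
      h₃.deduction.toNA, (Entails.mp (.of_contrapose χ ψ) h₄.deduction).toNA⟩
  · obtain ⟨S, hS₀, hS⟩ := exists_isMaxInseparable (by
      rintro s a (ha | ha) <;> cases ha <;> exact fun b => by simp [A]) hsep
    obtain ⟨v, hv, hNA, htruth⟩ := hS.exists_valuation
    exact ((htruth ψ).2 false (hS₀ (.inr rfl)) ((hv.imp _ _).1 (hNA _ h)
      ((htruth φ).1 true (hS₀ (.inl rfl))))).elim
end
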